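/- Let N ⊆ M be hyperfinite II₁ factors with N' ∩ M = ℂ1 and let ω be a free ultrafilter on ℕ. If M' ∩ M^ω ⊆ N^ω, then the Jones index [M : N] is finite. -/

import Mathlib

open scoped ComplexOrder
open Filter

namespace PopaQ

variable {H : Type u} [NormedAddCommGroup H] [InnerProductSpace ℂ H] [CompleteSpace H]

/-- Bounded operators on `H`. -/
abbrev Op (H : Type u) [NormedAddCommGroup H] [InnerProductSpace ℂ H] [CompleteSpace H] :=
  H →L[ℂ] H

/-- The relative commutant `N' ∩ M` (as sets of operators). -/
def relComm (N M : Set (Op H)) : Set (Op H) :=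
  {x | x ∈ M ∧ ∀ y ∈ N, y * x = x * y}

/-- The scalar operators `ℂ 1`. -/
def scalars (H : Type u) [NormedAddCommGroup H] [InnerProductSpace ℂ H] [CompleteSpace H] :
    Set (Op H) :=
  {x | ∃ c : ℂ, x = c • (1 : Op H)}

/-- A (self-adjoint) projection. -/
def IsProjection (p : Op H) : Prop :=
  IsSelfAdjoint p ∧ IsIdempotentElem p

/-- `τ` is a faithful tracial state on `M`. -/
structure IsTracialState (M : Set (Op H)) (τ : Op H →ₗ[ℂ] ℂ) : Prop where
  map_one : τ 1 = 1
  tracial : ∀ x ∈ M, ∀ y ∈ M, τ (x * y) = τ (y * x)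
  pos : ∀ x ∈ M, 0 ≤ τ (star x * x)
  faithful : ∀ x ∈ M, τ (star x * x) = 0 → x = 0

/-- A set of operators is finite dimensional as a complex vector space. -/
def FinDim (S : Set (Op H)) : Prop :=
  ∃ s : Finset (Op H), S ⊆ (Submodule.span ℂ (s : Set (Op H)) : Set (Op H))

/-- `M` is a II₁ factor with faithful normal trace `τ`:
a factor (trivial center) carrying a faithful tracial state, which is
infinite dimensional. -/
structure IsII1Factor (M : VonNeumannAlgebra H) (τ : Op H →ₗ[ℂ] ℂ) : Prop where
  factor : relComm (M : Set (Op H)) (M : Set (Op H)) = scalars H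
  trace : IsTracialState (M : Set (Op H)) τ
  infdim : ¬ FinDim (M : Set (Op H))

/-- `M` is hyperfinite: it is the (weak closure = double commutant) of an increasing
union of finite-dimensional *-subalgebras. -/
def IsHyperfinite (M : VonNeumannAlgebra H) : Prop :=
  ∃ A : ℕ → StarSubalgebra ℂ (Op H),
    Monotone A ∧ (∀ n, (A n : Set (Op H)) ⊆ M) ∧ (∀ n, FinDim (A n : Set (Op H))) ∧
    Set.centralizer (Set.centralizer (⋃ n, (A n : Set (Op H)))) = (M : Set (Op H))

/-- A bounded sequence of operators. -/
def Bdd (x : ℕ → Op H) : Prop :=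
  ∃ C : ℝ, ∀ n, ‖x n‖ ≤ C

/-- A sequence taking values in `S`. -/
def SeqIn (S : Set (Op H)) (x : ℕ → Op H) : Prop :=
  ∀ n, x n ∈ S

/-- A free ultrafilter on ℕ. -/
def IsFreeUltrafilter (ω : Ultrafilter ℕ) : Prop :=
  ∀ s : Set ℕ, s.Finite → s ∉ ω

/-- `Mω` is the tracial ultrapower of `M` along `ω`, with trace `τ`;
`limω` assigns to each bounded sequence in `M` its class in `Mω` (the diagonal
embedding of `M` into `Mω` being the identity on `M`). -/
structure IsTracialUltrapower (ω : Ultrafilter ℕ) (M Mω : VonNeumannAlgebra H)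
    (τ : Op H →ₗ[ℂ] ℂ) (limω : (ℕ → Op H) → Op H) : Prop where
  subset : (M : Set (Op H)) ⊆ (Mω : Set (Op H))
  mem : ∀ x, SeqIn (M : Set (Op H)) x → Bdd x → limω x ∈ Mω
  diag : ∀ m ∈ M, limω (fun _ => m) = m
  map_add : ∀ x y, SeqIn (M : Set (Op H)) x → Bdd x → SeqIn (M : Set (Op H)) y → Bdd y →
    limω (fun n => x n + y n) = limω x + limω y
  map_mul : ∀ x y, SeqIn (M : Set (Op H)) x → Bdd x → SeqIn (M : Set (Op H)) y → Bdd y →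
    limω (fun n => x n * y n) = limω x * limω y
  map_smul : ∀ (c : ℂ) x, SeqIn (M : Set (Op H)) x → Bdd x →
    limω (fun n => c • x n) = c • limω x
  map_star : ∀ x, SeqIn (M : Set (Op H)) x → Bdd x →
    limω (fun n => star (x n)) = star (limω x)
  surj : ∀ z ∈ Mω, ∃ x, SeqIn (M : Set (Op H)) x ∧ Bdd x ∧ limω x = z
  tr : ∀ x, SeqIn (M : Set (Op H)) x → Bdd x →
    Tendsto (fun n => τ (x n)) (ω : Filter ℕ) (nhds (τ (limω x)))
  eq_zero : ∀ x, SeqIn (M : Set (Op H)) x → Bdd x →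
    (limω x = 0 ↔ Tendsto (fun n => ‖τ (star (x n) * x n)‖) (ω : Filter ℕ) (nhds 0))
  traceState : IsTracialState (Mω : Set (Op H)) τ

/-- The ultrapower `N^ω ⊆ M^ω` of a subalgebra `N ⊆ M`: classes of bounded
sequences with entries in `N`. -/
def ultrapowerSet (limω : (ℕ → Op H) → Op H) (N : Set (Op H)) : Set (Op H) :=
  {z | ∃ x, SeqIn N x ∧ Bdd x ∧ limω x = z}

/-- `θ` is a *-homomorphism from `S` to `T` (as sets of operators). -/
def IsStarHomOn (θ : Op H → Op H) (S T : Set (Op H)) : Prop :=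
  (∀ x ∈ S, θ x ∈ T) ∧
  (∀ x ∈ S, ∀ y ∈ S, θ (x + y) = θ x + θ y) ∧
  (∀ x ∈ S, ∀ y ∈ S, θ (x * y) = θ x * θ y) ∧
  (∀ (c : ℂ), ∀ x ∈ S, θ (c • x) = c • θ x) ∧
  (∀ x ∈ S, θ (star x) = star (θ x))

/-- The corner `p S p` of a set of operators. -/
def corner (p : Op H) (S : Set (Op H)) : Set (Op H) :=
  {x | x ∈ S ∧ p * x * p = x}

/-- Popa's intertwining relation: a corner of `P` embeds into `Q` inside `M`,
written `P ≺_M Q`: there are nonzero projections `p ∈ P`, `q ∈ Q`, a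
*-homomorphism `θ : pPp → qQq` and a nonzero partial isometry `v ∈ qMp` with
`θ(x) v = v x` for all `x ∈ pPp`. -/
def CornerEmbeds (P Q M : Set (Op H)) : Prop :=
  ∃ (p q v : Op H) (θ : Op H → Op H),
    p ∈ P ∧ IsProjection p ∧ p ≠ 0 ∧
    q ∈ Q ∧ IsProjection q ∧ q ≠ 0 ∧
    IsStarHomOn θ (corner p P) (corner q Q) ∧
    v ∈ M ∧ v ≠ 0 ∧ IsProjection (star v * v) ∧ q * v * p = v ∧
    ∀ x ∈ corner p P, θ x * v = v * x

/-- `E` is the (`τ`-preserving) conditional expectation from `M` onto `Q`. -/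
structure IsCondExp (τ : Op H →ₗ[ℂ] ℂ) (M Q : Set (Op H)) (E : Op H → Op H) : Prop where
  mem : ∀ x ∈ M, E x ∈ Q
  fix : ∀ q ∈ Q, E q = q
  map_add : ∀ x ∈ M, ∀ y ∈ M, E (x + y) = E x + E y
  map_smul : ∀ (c : ℂ), ∀ x ∈ M, E (c • x) = c • E x
  bimod : ∀ a ∈ Q, ∀ x ∈ M, ∀ b ∈ Q, E (a * x * b) = a * E x * b
  tr : ∀ x ∈ M, τ (E x) = τ x

/-- `c` is a Pimsner–Popa bound for the inclusion `Q ⊆ M` with conditional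
expectation `E`: every positive `x ∈ M` satisfies `x ≤ c E(x)`. -/
def IndexBound (M : Set (Op H)) (E : Op H → Op H) (c : ℝ) : Prop :=
  ∀ x ∈ M, x.IsPositive → (c • E x - x).IsPositive

/-- The inclusion `Q ⊆ M` (with conditional expectation `E`) has finite Jones index. -/
def HasFiniteIndex (M : Set (Op H)) (E : Op H → Op H) : Prop :=
  ∃ c : ℝ, 0 < c ∧ IndexBound M E c

/-- The Jones index `[M : Q]` of an inclusion `Q ⊆ M` with conditional expectation `E`,
via the Pimsner–Popa characterization as the optimal constant `c` with
`x ≤ c E(x)` for all positive `x ∈ M`. -/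
noncomputable def jonesIndex (M : Set (Op H)) (E : Op H → Op H) : ℝ :=
  sInf {c : ℝ | 0 < c ∧ IndexBound M E c}



theorem kolm {X : Type u} (G : X → X → ℂ) (herm : ∀ x y, star (G x y) = G y x)
    (pos : ∀ f : X →₀ ℂ, 0 ≤ (f.sum fun x z => f.sum fun y w => star z * w * G x y).re) :
    ∃ (K : Type u) (_ : NormedAddCommGroup K) (_ : InnerProductSpace ℂ K) (_ : CompleteSpace K)
      (v : X → K), (∀ x y, inner ℂ (v x) (v y) = G x y) ∧
        Dense ((Submodule.span ℂ (Set.range v) : Submodule ℂ K) : Set K) := by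
  let V := X →₀ ℂ
  let core : PreInnerProductSpace.Core ℂ V :=
    { inner := fun f g => f.sum fun x z => g.sum fun y w => star z * w * G x y
      conj_inner_symm := fun f g => by
        rw [Finsupp.sum_comm]
        simp only [map_finsuppSum]
        refine Finsupp.sum_congr fun x _ => Finsupp.sum_congr fun y _ => ?_
        rw [← herm]
        simp [mul_comm]
      add_left := fun f g h => by
        rw [Finsupp.sum_add_index'] <;> simp [← Finsupp.sum_add, add_mul]
      smul_left := fun f g c => by
        rw [Finsupp.sum_smul_index] <;> simp [Finsupp.mul_sum, ← mul_assoc]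
      re_inner_nonneg := pos }
  letI i1 : SeminormedAddCommGroup V := InnerProductSpace.Core.toSeminormedAddCommGroup (𝕜 := ℂ)
  letI i2 : InnerProductSpace ℂ V := InnerProductSpace.ofCore _
  refine ⟨UniformSpace.Completion V, inferInstance, inferInstance, inferInstance,
    fun x => ((Finsupp.single x 1 : V) : UniformSpace.Completion V), ?_, ?_⟩
  · intro x y
    rw [UniformSpace.Completion.inner_coe]
    change (Finsupp.single x (1 : ℂ)).sum (fun x z => (Finsupp.single y (1 : ℂ)).sum
      fun y w => star z * w * G x y) = _
    simp
  · have h1 : DenseRange ((↑) : V → UniformSpace.Completion V) :=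
      UniformSpace.Completion.denseRange_coe
    refine h1.mono ?_
    rintro _ ⟨f, rfl⟩
    have h2 : f ∈ Submodule.span ℂ (Set.range fun x : X => (Finsupp.single x 1 : V)) := by
      have := Finsupp.range_linearCombination ℂ (v := fun x : X => (Finsupp.single x 1 : V))
      rw [← this]
      exact ⟨f, by simp [Finsupp.linearCombination_apply]⟩
    have h3 := Submodule.apply_mem_span_image_of_mem_span
      (UniformSpace.Completion.toComplₗᵢ (𝕜 := ℂ) (E := V)).toLinearMap h2
    rw [← Set.range_comp] at h3
    exact h3

theorem ext_op {X : Type*} {K : Type*} [NormedAddCommGroup K] [InnerProductSpace ℂ K]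
    [CompleteSpace K] (v : X → K)
    (hd : Dense ((Submodule.span ℂ (Set.range v) : Submodule ℂ K) : Set K))
    (T : X → X) (C : ℝ)
    (h : ∀ f : X →₀ ℂ, ‖f.sum fun x z => z • v (T x)‖ ≤ C * ‖f.sum fun x z => z • v x‖) :
    ∃ S : K →L[ℂ] K, (∀ x, S (v x) = v (T x)) ∧ ∀ k, ‖S k‖ ≤ C * ‖k‖ := by
  let e := Finsupp.linearCombination ℂ v
  let f := Finsupp.linearCombination ℂ (v ∘ T)
  have hde : DenseRange e := by
    have : Set.range e = (Submodule.span ℂ (Set.range v) : Submodule ℂ K) := by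
      rw [← Finsupp.range_linearCombination]; rfl
    rw [DenseRange, this]; exact hd
  have hn : ∀ x, ‖f x‖ ≤ C * ‖e x‖ := fun x => by
    simpa [e, f, Finsupp.linearCombination_apply] using h x
  refine ⟨f.extendOfNorm e, fun x => ?_, fun k => LinearMap.norm_extendOfNorm_apply_le hde C hn k⟩
  have := LinearMap.extendOfNorm_eq (f := f) (e := e) hde ⟨C, hn⟩ (Finsupp.single x 1)
  simpa [e, f] using this

/-- Minimal norm fixed point. -/
theorem fixed_pt {K : Type*} [NormedAddCommGroup K] [InnerProductSpace ℂ K] [CompleteSpace K]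
    (S : Set K) (hne : S.Nonempty) (hcl : IsClosed S) (hcv : Convex ℝ S)
    (G : Set (K → K)) (hG : ∀ g ∈ G, (∀ x, ‖g x‖ = ‖x‖) ∧ ∀ x ∈ S, g x ∈ S) :
    ∃ η ∈ S, ∀ g ∈ G, g η = η := by
  letI : InnerProductSpace ℝ K := InnerProductSpace.rclikeToReal ℂ K
  obtain ⟨η, hη, hmin⟩ := exists_norm_eq_iInf_of_complete_convex hne hcl.isComplete hcv 0
  simp only [zero_sub, norm_neg] at hmin
  have hle : ∀ w ∈ S, ‖η‖ ≤ ‖w‖ := fun w hw => by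
    rw [hmin]
    exact ciInf_le (f := fun w : S => ‖(w : K)‖)
      ⟨0, Set.forall_mem_range.2 fun _ => norm_nonneg _⟩ ⟨w, hw⟩
  refine ⟨η, hη, fun g hg => ?_⟩
  have h1 := (hG g hg).1 η
  have h2 := (hG g hg).2 η hη
  have h3 : (1/2 : ℝ) • g η + (1/2 : ℝ) • η ∈ S := hcv h2 hη (by norm_num) (by norm_num) (by norm_num)
  have h4 := hle _ h3
  have h5 : (1/2 : ℝ) • g η + (1/2 : ℝ) • η = (1/2 : ℝ) • (g η + η) := by rw [smul_add]
  rw [h5, norm_smul] at h4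
  have h6 := parallelogram_law_with_norm ℝ (g η) η
  have h7 : ‖g η - η‖ = 0 := by
    norm_num at h4
    rw [h1] at h6
    nlinarith [norm_nonneg (g η - η), norm_nonneg η, norm_nonneg (g η + η)]
  exact sub_eq_zero.mp (norm_eq_zero.mp h7)

theorem neg_part {C : Type*} [CStarAlgebra C] (x : C) (hx : IsSelfAdjoint x) :
    ∃ S Y W : C, x = star S * S - Y ∧ Y = star W * W ∧ x * Y = - (Y * Y) ∧ star Y = Y := by
  letI := CStarAlgebra.spectralOrder C
  haveI := CStarAlgebra.spectralOrderedRing C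
  have h1 : 0 ≤ x⁺ := CFC.posPart_nonneg x
  have h2 : 0 ≤ x⁻ := CFC.negPart_nonneg x
  obtain ⟨S, hS⟩ := CStarAlgebra.nonneg_iff_eq_star_mul_self.mp h1
  obtain ⟨W, hW⟩ := CStarAlgebra.nonneg_iff_eq_star_mul_self.mp h2
  refine ⟨S, x⁻, W, ?_, hW, ?_, (IsSelfAdjoint.of_nonneg h2).star_eq⟩
  · rw [← hS, CFC.posPart_sub_negPart x]
  · have := CFC.posPart_sub_negPart x
    nth_rewrite 1 [← this]
    rw [sub_mul, CFC.posPart_mul_negPart, zero_sub]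

theorem cube_zero {C : Type*} [CStarAlgebra C] (Y W : C) (hY : star Y = Y) (hW : Y = star W * W)
    (h : W * Y = 0) : Y = 0 := by
  have h2 : star Y * Y = 0 := by rw [hY]; nth_rewrite 1 [hW]; rw [mul_assoc, h, mul_zero]
  exact CStarRing.star_mul_self_eq_zero_iff Y |>.mp h2




structure Setup {A : Type u} [CStarAlgebra A] (τ : A →ₗ[ℂ] ℂ) (N : StarSubalgebra ℂ A)
    (E : A →ₗ[ℂ] A) : Prop where
  one : τ 1 = 1
  tr : ∀ x y, τ (x * y) = τ (y * x)
  pos : ∀ x, 0 ≤ τ (star x * x)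
  faith : ∀ x, τ (star x * x) = 0 → x = 0
  mem : ∀ x, E x ∈ N
  fix : ∀ x ∈ N, E x = x
  bim : ∀ a ∈ N, ∀ x, ∀ b ∈ N, E (a * x * b) = a * E x * b
  etr : ∀ x, τ (E x) = τ x
  closed : IsClosed (N : Set A)
  complete : ∀ (y : ℕ → A) (C : ℝ), (∀ n, ‖y n‖ ≤ C) →
    (∀ ε > 0, ∃ n₀, ∀ m ≥ n₀, ∀ n ≥ n₀, (τ (star (y m - y n) * (y m - y n))).re < ε) →
    ∃ z, Tendsto (fun n => (τ (star (y n - z) * (y n - z))).re) atTop (nhds 0)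
  irr : ∀ x, (∀ y ∈ N, y * x = x * y) → ∃ c : ℂ, x = c • 1

section
variable {A : Type u} [CStarAlgebra A] {τ : A →ₗ[ℂ] ℂ} {N : StarSubalgebra ℂ A} {E : A →ₗ[ℂ] A}

theorem Setup.tstar (h : Setup τ N E) (x : A) : τ (star x) = star (τ x) := by
  have h1 := (Complex.nonneg_iff.mp (h.pos (1 + x))).2
  have h2 := (Complex.nonneg_iff.mp (h.pos (1 + Complex.I • x))).2
  have h3 := (Complex.nonneg_iff.mp (h.pos x)).2
  simp [add_mul, mul_add, h.one, ← h3] at h1 h2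
  apply Complex.ext <;> simp <;> linarith

theorem Setup.bl (h : Setup τ N E) {a : A} (ha : a ∈ N) (x : A) : E (a * x) = a * E x := by
  simpa using h.bim a ha x 1 (one_mem _)
theorem Setup.br (h : Setup τ N E) {a : A} (ha : a ∈ N) (x : A) : E (x * a) = E x * a := by
  simpa using h.bim 1 (one_mem _) x a ha

theorem Setup.tE (h : Setup τ N E) {a : A} (ha : a ∈ N) (x : A) : τ (a * E x) = τ (a * x) := by
  rw [← h.bl ha, h.etr]

theorem Setup.tE' (h : Setup τ N E) {a : A} (ha : a ∈ N) (x : A) : τ (E x * a) = τ (x * a) := by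
  rw [h.tr, h.tE ha, h.tr]

theorem Setup.estar (h : Setup τ N E) (x : A) : E (star x) = star (E x) := by
  rw [← sub_eq_zero]
  have hm : E (star x) - star (E x) ∈ N := sub_mem (h.mem _) (star_mem (h.mem _))
  apply h.faith
  have hm' := star_mem hm
  have : τ (star (E (star x) - star (E x)) * E (star x)) =
     τ (star (E (star x) - star (E x)) * star (E x)) := by
    rw [h.tE hm']
    rw [← star_star (_ * star x), h.tstar, star_mul, star_star, star_star, ← h.tE' hm, ← h.tstar,
      star_mul]
  rw [mul_sub, map_sub, this, sub_self]

theorem Setup.conj_le (h : Setup τ N E) (x y : A) :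
    (τ (star (x * y) * (x * y))).re ≤ ‖x‖ ^ 2 * (τ (star y * y)).re := by
  let := CStarAlgebra.spectralOrder A
  have := CStarAlgebra.spectralOrderedRing A
  have h1 : star x * x ≤ algebraMap ℝ A (‖x‖ ^ 2) := by
    have := CStarAlgebra.star_mul_le_algebraMap_norm_sq (a := x)
    exact this
  obtain ⟨z, hz⟩ := CStarAlgebra.nonneg_iff_eq_star_mul_self.mp (sub_nonneg.mpr h1)
  have h2 := (Complex.nonneg_iff.mp (h.pos (z * y))).1
  have h3 : star (z * y) * (z * y) = ((‖x‖ ^ 2 : ℝ) : ℂ) • (star y * y) - star (x * y) * (x * y) := by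
    rw [star_mul, star_mul]
    calc star y * star z * (z * y) = star y * (star z * z) * y := by noncomm_ring
      _ = _ := by
        rw [← hz, mul_sub, sub_mul, Algebra.algebraMap_eq_smul_one]
        simp [mul_assoc]
        rw [← Complex.coe_smul]; push_cast; rfl
  rw [h3, map_sub, map_smul] at h2
  simp only [Complex.sub_re, smul_eq_mul, Complex.re_ofReal_mul] at h2
  linarith

theorem Setup.cp (h : Setup τ N E) {ι : Type*} [Fintype ι] [DecidableEq ι] (a : ι → A) :
    ∃ S : ι → ι → A, ∀ i j, E (star (a i) * a j) = ∑ k, star (S k i) * S k j := by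
  have := h.closed
  let := CStarAlgebra.spectralOrder N
  have := CStarAlgebra.spectralOrderedRing N
  let X : CStarMatrix ι ι N := CStarMatrix.ofMatrix fun i j => ⟨E (star (a i) * a j), h.mem _⟩
  have hX : IsSelfAdjoint X := by
    ext i j
    rw [CStarMatrix.star_apply]
    change star (E (star (a j) * a i)) = E (star (a i) * a j)
    rw [← h.estar, star_mul, star_star]
  obtain ⟨S, Y, W, h1, h2, h3, h4⟩ := neg_part X hX
  have key : Y = 0 := by
    apply cube_zero Y W h4 h2
    have h5 : Y * X * Y = - (star (W * Y) * (W * Y)) := by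
      rw [mul_assoc, h3, star_mul, h4]; nth_rewrite 2 [h2]; noncomm_ring
    have h6 : ∀ i, τ ((Y * X * Y) i i : N) = τ (star (∑ l, a l * (Y l i : N)) * ∑ l, a l * (Y l i : N)) := by
      intro i
      have hY : ∀ l, ((Y i l : N) : A) = star ((Y l i : N) : A) := fun l => by
        conv_lhs => rw [← h4]
        rw [CStarMatrix.star_apply]; rfl
      have hXa : ∀ l m, ((X l m : N) : A) = E (star (a l) * a m) := fun l m => rfl
      have e1 : (((Y * X * Y) i i : N) : A) = ∑ m, (∑ l, ((Y i l : N) : A) * X l m) * Y m i := by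
        simp [CStarMatrix.mul_apply]
      rw [e1, star_sum, Finset.sum_mul_sum, Finset.sum_comm]
      simp only [map_sum, Finset.sum_mul]
      refine Finset.sum_congr rfl fun m _ => Finset.sum_congr rfl fun l _ => ?_
      rw [hXa, hY, ← h.bim _ (star_mem (Y l i).2) _ _ (Y m i).2, h.etr, star_mul]
      congr 1; noncomm_ring
    have h7 : ∀ i, τ ((Y * X * Y) i i : N) = - ∑ k, τ (star ((W * Y) k i : A) * ((W * Y) k i : N)) := by
      intro i
      rw [h5]
      simp [CStarMatrix.mul_apply, CStarMatrix.star_apply]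
    have h8 : ∀ i k, τ (star ((W * Y) k i : A) * ((W * Y) k i : N)) = 0 := by
      intro i k
      have := h.pos (∑ l, a l * (Y l i : N))
      rw [← h6, h7] at this
      have h9 : ∀ k, 0 ≤ τ (star ((W * Y) k i : A) * ((W * Y) k i : N)) := fun k => h.pos _
      have h10 := Finset.sum_nonneg (s := Finset.univ) fun k _ => h9 k
      have h11 := le_antisymm (neg_nonneg.mp this) h10
      exact (Finset.sum_eq_zero_iff_of_nonneg (fun k _ => h9 k)).mp h11 k (Finset.mem_univ _)
    ext k i
    exact h.faith _ (h8 i k)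
  refine ⟨fun i j => (S i j : N), fun i j => ?_⟩
  rw [key, sub_zero] at h1
  have := congrArg (fun Z : CStarMatrix ι ι N => ((Z i j : N) : A)) h1
  have e : ((X i j : N) : A) = E (star (a i) * a j) := rfl
  rw [← e]
  simpa [CStarMatrix.mul_apply, CStarMatrix.star_apply] using this

theorem Setup.cp' (h : Setup τ N E) {X : Type*} (s : Finset X) (a : X → A) :
    ∃ S : s → X → A, ∀ b : X → A,
      ∑ i ∈ s, ∑ j ∈ s, τ (star (b i) * E (star (a i) * a j) * b j) =
        ∑ k, τ (star (∑ j ∈ s, S k j * b j) * (∑ j ∈ s, S k j * b j)) := by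
  classical
  obtain ⟨S, hS⟩ := h.cp (fun i : s => a i)
  refine ⟨fun k j => if hj : j ∈ s then S k ⟨j, hj⟩ else 0, fun b => ?_⟩
  have e1 : ∀ k, (∑ j ∈ s, (if hj : j ∈ s then S k ⟨j, hj⟩ else 0) * b j) =
      ∑ j : s, S k j * b j := fun k => by
    rw [← Finset.sum_coe_sort s]
    simp
  simp only [e1]
  have e2 : ∑ i ∈ s, ∑ j ∈ s, τ (star (b i) * E (star (a i) * a j) * b j) =
      ∑ i : s, ∑ j : s, τ (star (b i) * E (star (a i) * a j) * b j) := by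
    rw [← Finset.sum_coe_sort s]
    refine Finset.sum_congr rfl fun i _ => ?_
    rw [← Finset.sum_coe_sort s]
  rw [e2]
  simp only [star_sum, Finset.sum_mul_sum, map_sum]
  rw [Finset.sum_comm (s := Finset.univ (α := s)) (t := Finset.univ (α := s))
    (f := fun k i => ∑ j : s, τ (star (S k i * b i) * (S k j * b j)))]
  refine Finset.sum_congr rfl fun i _ => ?_
  rw [Finset.sum_comm]
  refine Finset.sum_congr rfl fun j _ => ?_
  rw [hS, Finset.mul_sum, Finset.sum_mul, map_sum]
  refine Finset.sum_congr rfl fun k _ => ?_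
  rw [star_mul]; congr 1; noncomm_ring

/-- The bimodule. -/
structure IsBM {K : Type u} [NormedAddCommGroup K] [InnerProductSpace ℂ K] [CompleteSpace K]
    (τ : A →ₗ[ℂ] ℂ) (E : A →ₗ[ℂ] A) (v : A → A → K) (L R : A → K →L[ℂ] K) : Prop where
  inn : ∀ a b c d, inner ℂ (v a b) (v c d) = τ (star b * E (star a * c) * d)
  dense : Dense ((Submodule.span ℂ (Set.range fun p : A × A => v p.1 p.2) : Submodule ℂ K) : Set K)
  Lv : ∀ x a b, L x (v a b) = v (x * a) b
  Rv : ∀ x a b, R x (v a b) = v a (b * x)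
  Ln : ∀ x k, ‖L x k‖ ≤ ‖x‖ * ‖k‖
  Rn : ∀ x k, ‖R x k‖ ≤ ‖x‖ * ‖k‖

theorem Setup.nsq (h : Setup τ N E) {K : Type u} [NormedAddCommGroup K] [InnerProductSpace ℂ K]
    (v : A × A → K) (hv : ∀ x y, inner ℂ (v x) (v y) = τ (star x.2 * E (star x.1 * y.1) * y.2))
    (f : A × A →₀ ℂ) (p q : A × A → A) :
    ‖f.sum fun x z => z • v (p x, q x)‖ ^ 2 = 
     (∑ i ∈ f.support, ∑ j ∈ f.support, τ (star (f i • q i) * E (star (p i) * p j) * (f j • q j))).re := by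
  rw [← inner_self_eq_norm_sq (𝕜 := ℂ)]
  change (inner ℂ _ _).re = _
  congr 1
  simp only [Finsupp.sum, sum_inner, inner_sum, inner_smul_left, inner_smul_right, hv]
  rw [Finset.sum_comm]
  simp only [star_smul, smul_mul_assoc, mul_smul_comm, map_smul, smul_eq_mul]
  refine Finset.sum_congr rfl fun m _ => ?_
  first
    | rw [Finset.mul_sum]; refine Finset.sum_congr rfl fun l _ => ?_
    | refine Finset.sum_congr rfl fun l _ => ?_
  simp
  try ring

theorem Setup.exBM (h : Setup τ N E) :
    ∃ (K : Type u) (_ : NormedAddCommGroup K) (_ : InnerProductSpace ℂ K) (_ : CompleteSpace K)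
      (v : A → A → K) (L R : A → K →L[ℂ] K), IsBM τ E v L R := by
  obtain ⟨K, i1, i2, i3, v, hv, hd⟩ := kolm (X := A × A)
    (fun x y => τ (star x.2 * E (star x.1 * y.1) * y.2))
    (fun x y => by rw [← h.tstar]; simp [← h.estar, mul_assoc])
    (fun f => by
      obtain ⟨S, hS⟩ := h.cp' f.support (fun x => x.1)
      have h1 := hS (fun x => f x • x.2)
      have h2 : (f.sum fun x z => f.sum fun y w => star z * w * τ (star x.2 * E (star x.1 * y.1) * y.2)) =
        ∑ i ∈ f.support, ∑ j ∈ f.support, τ (star (f i • i.2) * E (star i.1 * j.1) * (f j • j.2)) := by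
        simp only [Finsupp.sum]
        refine Finset.sum_congr rfl fun m _ => Finset.sum_congr rfl fun l _ => ?_
        simp
        ring
      rw [h2, h1]
      exact (Complex.nonneg_iff.mp (Finset.sum_nonneg fun k _ => h.pos _)).1)
  have hL : ∀ x : A, ∃ S : K →L[ℂ] K, (∀ y, S (v y) = v (x * y.1, y.2)) ∧ ∀ k, ‖S k‖ ≤ ‖x‖ * ‖k‖ := by
    intro x
    refine ext_op v hd (fun y => (x * y.1, y.2)) ‖x‖ fun f => ?_
    refine (pow_le_pow_iff_left₀ (norm_nonneg _) (by positivity) two_ne_zero).mp ?_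
    rw [mul_pow, h.nsq v hv f (fun y => x * y.1) (fun y => y.2), h.nsq v hv f (fun y => y.1) (fun y => y.2)]
    let := CStarAlgebra.spectralOrder A
    have := CStarAlgebra.spectralOrderedRing A
    have h1 : star x * x ≤ algebraMap ℝ A (‖x‖ ^ 2) :=
      CStarAlgebra.star_mul_le_algebraMap_norm_sq (a := x)
    obtain ⟨z, hz⟩ := CStarAlgebra.nonneg_iff_eq_star_mul_self.mp (sub_nonneg.mpr h1)
    obtain ⟨S, hS⟩ := h.cp' f.support (fun y => z * y.1)
    have h2 := (Complex.nonneg_iff.mp (Finset.sum_nonneg fun k _ => h.pos _ : 0 ≤ ∑ k, τ (star (∑ j ∈ f.support, S k j * (f j • j.2)) * (∑ j ∈ f.support, S k j * (f j • j.2))))).1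
    rw [← hS (fun y => f y • y.2)] at h2
    obtain ⟨b, hb⟩ : ∃ b : A × A → A, ∀ y, f y • y.2 = b y := ⟨_, fun _ => rfl⟩
    simp only [hb] at h2 ⊢
    have h3 : ∀ a b : A, star (z * a) * (z * b) = ((‖x‖ ^ 2 : ℝ) : ℂ) • (star a * b) - star (x * a) * (x * b) := by
      intro a b
      rw [star_mul, star_mul]
      calc star a * star z * (z * b) = star a * (star z * z) * b := by noncomm_ring
        _ = _ := by
          rw [← hz, mul_sub, sub_mul, Algebra.algebraMap_eq_smul_one]
          simp [mul_assoc]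
          rw [← Complex.coe_smul]; push_cast; rfl
    simp only [h3, map_sub, map_smul, mul_sub, sub_mul, Finset.sum_sub_distrib, mul_smul_comm, smul_mul_assoc, ← Finset.smul_sum] at h2 ⊢
    rw [Complex.sub_re, smul_eq_mul, Complex.re_ofReal_mul] at h2
    linarith
  have hR : ∀ x : A, ∃ S : K →L[ℂ] K, (∀ y, S (v y) = v (y.1, y.2 * x)) ∧ ∀ k, ‖S k‖ ≤ ‖x‖ * ‖k‖ := by
    intro x
    refine ext_op v hd (fun y => (y.1, y.2 * x)) ‖x‖ fun f => ?_
    refine (pow_le_pow_iff_left₀ (norm_nonneg _) (by positivity) two_ne_zero).mp ?_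
    rw [mul_pow, h.nsq v hv f (fun y => y.1) (fun y => y.2 * x), h.nsq v hv f (fun y => y.1) (fun y => y.2)]
    obtain ⟨S, hS⟩ := h.cp' f.support (fun y => y.1)
    rw [hS, hS, Complex.re_sum, Complex.re_sum, Finset.mul_sum]
    refine Finset.sum_le_sum fun k _ => ?_
    have e : ∑ j ∈ f.support, S k j * (f j • (j.2 * x)) = (∑ j ∈ f.support, S k j * (f j • j.2)) * x := by
      rw [Finset.sum_mul]; simp [mul_assoc]
    rw [e]
    generalize (∑ j ∈ f.support, S k j * (f j • j.2)) = t
    have := h.conj_le (star x) (star t)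
    simp only [star_mul, star_star, norm_star] at this ⊢
    rw [h.tr (t) (star t)] at this
    refine le_trans (le_of_eq ?_) this
    congr 1
    rw [h.tr]
  choose L hL1 hL2 using hL
  choose R hR1 hR2 using hR
  exact ⟨K, i1, i2, i3, fun a b => v (a, b), L, R, ⟨fun a b c d => hv _ _, hd, fun x a b => hL1 x (a, b),
    fun x a b => hR1 x (a, b), hL2, hR2⟩⟩

end


section
variable {A : Type u} [CStarAlgebra A] {τ : A →ₗ[ℂ] ℂ} {N : StarSubalgebra ℂ A} {E : A →ₗ[ℂ] A}
  {K : Type u} [NormedAddCommGroup K] [InnerProductSpace ℂ K] [CompleteSpace K]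
  {v : A → A → K} {L R : A → K →L[ℂ] K}

theorem IsBM.ext (b : IsBM τ E v L R) {S T : K →L[ℂ] K} (h : ∀ x y, S (v x y) = T (v x y)) :
    S = T := by
  refine ContinuousLinearMap.ext_on b.dense ?_
  rintro _ ⟨p, rfl⟩
  exact h _ _

theorem IsBM.vext (b : IsBM τ E v L R) {k l : K} (h : ∀ x y, inner ℂ (v x y) k = inner ℂ (v x y) l) :
    k = l := by
  rw [← sub_eq_zero]
  refine b.dense.eq_zero_of_inner_right ℂ fun w hw => ?_
  change w ∈ Submodule.span ℂ (Set.range fun p : A × A => v p.1 p.2) at hw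
  induction hw using Submodule.span_induction with
  | mem x hx => obtain ⟨p, rfl⟩ := hx; simp [inner_sub_right, h]
  | zero => simp
  | add x y _ _ hx hy => simp [inner_add_left, hx, hy]
  | smul c x _ hx => simp [inner_smul_left, hx]

theorem IsBM.va (b : IsBM τ E v L R) (x y z : A) : v (x + y) z = v x z + v y z :=
  b.vext fun c d => by simp [b.inn, inner_add_right, mul_add, add_mul]
theorem IsBM.vs (b : IsBM τ E v L R) (c : ℂ) (x z : A) : v (c • x) z = c • v x z :=
  b.vext fun c d => by simp [b.inn, inner_smul_right]
theorem IsBM.va' (b : IsBM τ E v L R) (x y z : A) : v x (y + z) = v x y + v x z :=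
  b.vext fun c d => by simp [b.inn, inner_add_right, mul_add]
theorem IsBM.vs' (b : IsBM τ E v L R) (c : ℂ) (x z : A) : v x (c • z) = c • v x z :=
  b.vext fun c d => by simp [b.inn, inner_smul_right]
theorem IsBM.vsub (b : IsBM τ E v L R) (x y z : A) : v (x - y) z = v x z - v y z := by
  have := b.vs (-1) y z
  rw [sub_eq_add_neg, b.va, sub_eq_add_neg]; simpa using this

theorem IsBM.La (b : IsBM τ E v L R) (x y : A) (k : K) : L (x + y) k = L x k + L y k := by
  rw [b.ext (S := L (x + y)) (T := L x + L y) fun p q => by simp [b.Lv, b.va, add_mul]]; simp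
theorem IsBM.Ls (b : IsBM τ E v L R) (c : ℂ) (x : A) (k : K) : L (c • x) k = c • L x k := by
  rw [b.ext (S := L (c • x)) (T := c • L x) fun p q => by simp [b.Lv, b.vs]]; simp
theorem IsBM.Lm (b : IsBM τ E v L R) (x y : A) (k : K) : L (x * y) k = L x (L y k) := by
  rw [b.ext (S := L (x * y)) (T := L x * L y) fun p q => by simp [b.Lv, mul_assoc]]; simp
theorem IsBM.L1 (b : IsBM τ E v L R) (k : K) : L 1 k = k := by
  rw [b.ext (S := L 1) (T := 1) fun p q => by simp [b.Lv]]; simp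
theorem IsBM.Lsub (b : IsBM τ E v L R) (x y : A) (k : K) : L (x - y) k = L x k - L y k := by
  have := b.Ls (-1) y k
  rw [sub_eq_add_neg, b.La, sub_eq_add_neg]; simpa using this
theorem IsBM.L0 (b : IsBM τ E v L R) (k : K) : L 0 k = 0 := by simpa using b.Ls 0 0 k
theorem IsBM.Ra (b : IsBM τ E v L R) (x y : A) (k : K) : R (x + y) k = R x k + R y k := by
  rw [b.ext (S := R (x + y)) (T := R x + R y) fun p q => by simp [b.Rv, b.va', mul_add]]; simp
theorem IsBM.Rs (b : IsBM τ E v L R) (c : ℂ) (x : A) (k : K) : R (c • x) k = c • R x k := by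
  rw [b.ext (S := R (c • x)) (T := c • R x) fun p q => by simp [b.Rv, b.vs']]; simp
theorem IsBM.Rm (b : IsBM τ E v L R) (x y : A) (k : K) : R (x * y) k = R y (R x k) := by
  rw [b.ext (S := R (x * y)) (T := R y * R x) fun p q => by simp [b.Rv, mul_assoc]]; simp
theorem IsBM.R1 (b : IsBM τ E v L R) (k : K) : R 1 k = k := by
  rw [b.ext (S := R 1) (T := 1) fun p q => by simp [b.Rv]]; simp
theorem IsBM.Rsub (b : IsBM τ E v L R) (x y : A) (k : K) : R (x - y) k = R x k - R y k := by
  have := b.Rs (-1) y k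
  rw [sub_eq_add_neg, b.Ra, sub_eq_add_neg]; simpa using this
theorem IsBM.R0 (b : IsBM τ E v L R) (k : K) : R 0 k = 0 := by simpa using b.Rs 0 0 k
theorem IsBM.LR (b : IsBM τ E v L R) (x y : A) (k : K) : L x (R y k) = R y (L x k) := by
  have := b.ext (S := L x * R y) (T := R y * L x) fun p q => by simp [b.Rv, b.Lv]
  exact congrArg (fun S : K →L[ℂ] K => S k) this

theorem IsBM.Ladj (b : IsBM τ E v L R) (x : A) (k l : K) : inner ℂ (L x k) l = inner ℂ k (L (star x) l) := by
  have : ContinuousLinearMap.adjoint (L x) = L (star x) := b.ext fun p q => b.vext fun c d => by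
    rw [ContinuousLinearMap.adjoint_inner_right]
    simp [b.Lv, b.inn, mul_assoc]
  rw [← this, ContinuousLinearMap.adjoint_inner_right]

theorem IsBM.Radj (b : IsBM τ E v L R) (h : Setup τ N E) (x : A) (k l : K) :
    inner ℂ (R x k) l = inner ℂ k (R (star x) l) := by
  have : ContinuousLinearMap.adjoint (R x) = R (star x) := b.ext fun p q => b.vext fun c d => by
    rw [ContinuousLinearMap.adjoint_inner_right]
    simp only [b.Rv, b.inn, star_mul]
    rw [mul_assoc, mul_assoc, h.tr]; simp [mul_assoc]
  rw [← this, ContinuousLinearMap.adjoint_inner_right]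

theorem IsBM.innv (b : IsBM τ E v L R) (h : Setup τ N E) (x y : A) :
    inner ℂ (v x 1) (v y 1) = τ (star x * y) := by
  simp [b.inn, h.etr]

theorem IsBM.normv (b : IsBM τ E v L R) (h : Setup τ N E) (x : A) :
    ‖v x 1‖ ^ 2 = (τ (star x * x)).re := by
  rw [← b.innv h, ← inner_self_eq_norm_sq (𝕜 := ℂ)]; rfl

theorem IsBM.Lu (b : IsBM τ E v L R) {u : A} (hu : star u * u = 1) (k : K) : ‖L u k‖ = ‖k‖ := by
  refine (pow_left_inj₀ (norm_nonneg _) (norm_nonneg _) two_ne_zero).mp ?_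
  rw [← inner_self_eq_norm_sq (𝕜 := ℂ), ← inner_self_eq_norm_sq (𝕜 := ℂ), b.Ladj, ← b.Lm, hu, b.L1]

theorem IsBM.Ru (b : IsBM τ E v L R) (h : Setup τ N E) {u : A} (hu : u * star u = 1) (k : K) :
    ‖R u k‖ = ‖k‖ := by
  refine (pow_left_inj₀ (norm_nonneg _) (norm_nonneg _) two_ne_zero).mp ?_
  rw [← inner_self_eq_norm_sq (𝕜 := ℂ), ← inner_self_eq_norm_sq (𝕜 := ℂ), b.Radj h, ← b.Rm, hu, b.R1]

theorem IsBM.vinj (b : IsBM τ E v L R) (h : Setup τ N E) {x y : A} (hv : v x 1 = v y 1) : x = y := by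
  rw [← sub_eq_zero]
  apply h.faith
  rw [← b.innv h, b.vsub, hv, sub_self]; simp

/-- For `a ∈ N`, right multiplication is inside. -/
theorem IsBM.vN (b : IsBM τ E v L R) (h : Setup τ N E) {a : A} (ha : a ∈ N) (x y : A) :
    v (x * a) y = v x (a * y) :=
  b.vext fun c d => by
    rw [b.inn, b.inn, ← mul_assoc (star c), h.br ha]; simp [mul_assoc]

theorem span_uni (P : StarSubalgebra ℂ A) (hP : IsClosed (P : Set A)) {x : A} (hx : x ∈ P) :
    x ∈ Submodule.span ℂ {u : A | u ∈ unitary A ∧ u ∈ P} := by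
  have := hP
  have h1 : (⟨x, hx⟩ : P) ∈ Submodule.span ℂ (unitary P : Set P) := by
    rw [CStarAlgebra.span_unitary]; trivial
  have h2 := Submodule.apply_mem_span_image_of_mem_span P.subtype.toLinearMap h1
  refine Submodule.span_mono ?_ h2
  rintro _ ⟨u, hu, rfl⟩
  have h3 := Unitary.mem_iff.mp hu
  refine ⟨Unitary.mem_iff.mpr ⟨congrArg Subtype.val h3.1, congrArg Subtype.val h3.2⟩, u.2⟩

end


section
variable {A : Type u} [CStarAlgebra A] {τ : A →ₗ[ℂ] ℂ} {N : StarSubalgebra ℂ A} {E : A →ₗ[ℂ] A}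
  {K : Type u} [NormedAddCommGroup K] [InnerProductSpace ℂ K] [CompleteSpace K]
  {v : A → A → K} {L R : A → K →L[ℂ] K}

def orb (N : StarSubalgebra ℂ A) (L R : A → K →L[ℂ] K) (y : A) (k : K) : Set (A × K) :=
  {p | ∃ u, u ∈ unitary A ∧ u ∈ N ∧ p = (u * y * star u, L u (R (star u) k))}

theorem orb_norm {y : A} {k : K} {p : A × K} (hp : p ∈ convexHull ℝ (orb N L R y k)) : ‖p.1‖ ≤ ‖y‖ := by
  have h1 : Convex ℝ {p : A × K | ‖p.1‖ ≤ ‖y‖} := by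
    have := (convex_closedBall (0 : A) ‖y‖).linear_preimage (LinearMap.fst ℝ A K)
    have e : {p : A × K | ‖p.1‖ ≤ ‖y‖} = ⇑(LinearMap.fst ℝ A K) ⁻¹' Metric.closedBall 0 ‖y‖ := by
      ext p; simp
    rw [e]; exact this
  refine (convexHull_min ?_ h1) hp
  rintro _ ⟨u, hu, -, rfl⟩
  simp only [Set.mem_ofPred_eq]
  have := Unitary.mem_iff.mp hu
  have hn : ‖u‖ ≤ 1 := by
    rcases subsingleton_or_nontrivial A with h | h
    · simp [Subsingleton.elim u 0]
    · exact (CStarRing.norm_of_mem_unitary hu).le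
  calc _ ≤ ‖u‖ * ‖y‖ * ‖star u‖ := (norm_mul_le _ _).trans (by gcongr; exact norm_mul_le _ _)
    _ ≤ 1 * ‖y‖ * 1 := by gcongr; rwa [norm_star]
    _ = _ := by simp

theorem orb_tr (h : Setup τ N E) {y : A} {k : K} {p : A × K} (hp : p ∈ convexHull ℝ (orb N L R y k)) : τ p.1 = τ y := by
  have h1 : Convex ℝ {p : A × K | τ p.1 = τ y} := by
    have := (convex_singleton (τ y)).linear_preimage ((τ.restrictScalars ℝ) ∘ₗ (LinearMap.fst ℝ A K))
    exact this
  refine (convexHull_min ?_ h1) hp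
  rintro _ ⟨u, hu, -, rfl⟩
  simp only [Set.mem_ofPred_eq]
  rw [h.tr, ← mul_assoc, (Unitary.mem_iff.mp hu).1, one_mul]

theorem IsBM.avg (b : IsBM τ E v L R) (h : Setup τ N E) (y : A) (k : K) :
    ∃ (s : ℕ → A × K) (ζ : K), (∀ n, s n ∈ convexHull ℝ (orb N L R y k)) ∧
      Tendsto (fun n => v ((s n).1 - τ y • 1) 1) atTop (nhds 0) ∧
      Tendsto (fun n => (s n).2) atTop (nhds ζ) := by
  let φ : A × K →ₗ[ℂ] WithLp 2 (K × K) :=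
    { toFun := fun p => WithLp.toLp 2 (v p.1 1, p.2)
      map_add' := fun p q => by apply WithLp.ofLp_injective; ext <;> simp [b.va]
      map_smul' := fun c p => by apply WithLp.ofLp_injective; ext <;> simp [b.vs] }
  let C := convexHull ℝ (orb N L R y k)
  let g : A → K → K := fun u κ => L u (R (star u) κ)
  let G : A → WithLp 2 (K × K) → WithLp 2 (K × K) := fun u p => WithLp.toLp 2 (g u p.fst, g u p.snd)
  have hg : ∀ u ∈ unitary A, ∀ κ, ‖g u κ‖ = ‖κ‖ := fun u hu κ => by
    simp only [g]; rw [b.Lu (Unitary.mem_iff.mp hu).1, b.Ru h (by rw [star_star]; exact (Unitary.mem_iff.mp hu).1)]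
  have hgc : ∀ u, Continuous (g u) := fun u => (L u).continuous.comp (R (star u)).continuous
  have hGc : ∀ u, Continuous (G u) := fun u => by
    refine (WithLp.prod_continuous_toLp 2 K K).comp ?_
    exact ((hgc u).comp (continuous_fst.comp (WithLp.prod_continuous_ofLp 2 K K))).prodMk
      ((hgc u).comp (continuous_snd.comp (WithLp.prod_continuous_ofLp 2 K K)))
  have hv : ∀ u ∈ unitary A, u ∈ N → ∀ s, g u (v s 1) = v (u * s * star u) 1 := fun u hu hN s => by
    simp only [g]; rw [b.Rv, b.Lv, b.vN h (star_mem hN)]; simp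
  let α : A → A × K →ₗ[ℝ] A × K := fun u =>
    { toFun := fun p => (u * p.1 * star u, g u p.2)
      map_add' := fun p q => by ext <;> simp [g, mul_add, add_mul]
      map_smul' := fun c p => by ext <;> simp [g] }
  have hα : ∀ u ∈ unitary A, u ∈ N → ∀ p ∈ C, α u p ∈ C := fun u hu hN p hp => by
    have h1 : α u p ∈ α u '' C := ⟨p, hp, rfl⟩
    rw [LinearMap.image_convexHull] at h1
    refine convexHull_mono ?_ h1
    rintro _ ⟨_, ⟨w, hw, hwN, rfl⟩, rfl⟩
    refine ⟨u * w, mul_mem hu hw, mul_mem hN hwN, ?_⟩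
    simp only [α, g, LinearMap.coe_mk, AddHom.coe_mk, star_mul]
    rw [b.Lm, b.Rm, ← b.LR]; simp [mul_assoc]
  obtain ⟨η, hη, hfix⟩ := fixed_pt (closure (φ '' C))
    (by
      refine Set.Nonempty.closure (Set.Nonempty.image _ ?_)
      exact Set.Nonempty.mono (subset_convexHull ℝ _) ⟨_, 1, one_mem _, one_mem _, rfl⟩)
    isClosed_closure
    (((convex_convexHull ℝ _).linear_image (φ.restrictScalars ℝ)).closure)
    {f | ∃ u, u ∈ unitary A ∧ u ∈ N ∧ f = G u}
    (by
      rintro _ ⟨u, hu, hN, rfl⟩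
      constructor
      · intro x
        refine (pow_left_inj₀ (norm_nonneg _) (norm_nonneg _) two_ne_zero).mp ?_
        rw [WithLp.prod_norm_sq_eq_of_L2, WithLp.prod_norm_sq_eq_of_L2]
        simp [G, hg u hu]
      · intro x hx
        have h1 : G u x ∈ G u '' closure (φ '' C) := ⟨x, hx, rfl⟩
        refine closure_mono ?_ (image_closure_subset_closure_image (hGc u) h1)
        rintro _ ⟨_, ⟨p, hp, rfl⟩, rfl⟩
        refine ⟨α u p, hα u hu hN p hp, ?_⟩
        simp [φ, G, α, hv u hu hN])
  obtain ⟨w, hw, hlim⟩ := mem_closure_iff_seq_limit.mp hη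
  choose s hs hsw using hw
  have l1 : Tendsto (fun n => v (s n).1 1) atTop (nhds η.fst) := by
    have := ((continuous_fst.comp (WithLp.prod_continuous_ofLp 2 K K)).tendsto η).comp hlim
    refine this.congr fun n => ?_
    simp [← hsw, φ]
  have l2 : Tendsto (fun n => (s n).2) atTop (nhds η.snd) := by
    have := ((continuous_snd.comp (WithLp.prod_continuous_ofLp 2 K K)).tendsto η).comp hlim
    refine this.congr fun n => ?_
    simp [← hsw, φ]
  refine ⟨s, η.snd, hs, ?_, l2⟩
  obtain ⟨z, hz⟩ := h.complete (fun n => (s n).1) ‖y‖ (fun n => orb_norm (hs n)) (by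
    intro ε hε
    obtain ⟨n₀, hn⟩ := Metric.cauchySeq_iff.mp l1.cauchySeq (Real.sqrt ε) (by positivity)
    refine ⟨n₀, fun m hm n hn' => ?_⟩
    have := hn m hm n hn'
    rw [dist_eq_norm, ← b.vsub] at this
    rw [← b.normv h]
    exact (Real.lt_sqrt (norm_nonneg _)).mp this)
  have l3 : Tendsto (fun n => v ((s n).1 - z) 1) atTop (nhds 0) := by
    rw [tendsto_zero_iff_norm_tendsto_zero]
    have := (Real.continuous_sqrt.tendsto 0).comp hz
    rw [Real.sqrt_zero] at this
    refine this.congr fun n => ?_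
    simp only [Function.comp]
    rw [← b.normv h, Real.sqrt_sq (norm_nonneg _)]
  have l4 : Tendsto (fun n => v (s n).1 1) atTop (nhds (v z 1)) := by
    have := l3.add_const (v z 1)
    simpa [b.vsub] using this
  have l5 := tendsto_nhds_unique l1 l4
  have hzu : ∀ u ∈ unitary A, u ∈ N → u * z = z * u := fun u hu hN => by
    have h1 := hfix _ ⟨u, hu, hN, rfl⟩
    have h2 : g u η.fst = η.fst := by
      have := congrArg (fun p : WithLp 2 (K × K) => p.fst) h1
      simpa [G] using this
    rw [l5, hv u hu hN] at h2
    have h3 := b.vinj h h2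
    calc u * z = u * z * (star u * u) := by rw [(Unitary.mem_iff.mp hu).1, mul_one]
      _ = (u * z * star u) * u := by noncomm_ring
      _ = _ := by rw [h3]
  obtain ⟨c, hc⟩ := h.irr z (fun x hx => by
    have hx' := span_uni N h.closed hx
    clear hx
    induction hx' using Submodule.span_induction with
    | mem x hx => exact hzu x hx.1 hx.2
    | zero => simp
    | add x y _ _ hx hy => rw [add_mul, mul_add, hx, hy]
    | smul c x _ hx => rw [smul_mul_assoc, mul_smul_comm, hx])
  have hcτ : c = τ y := by
    have h1 : Tendsto (fun n => inner ℂ (v 1 1) (v (s n).1 1)) atTop (nhds (inner ℂ (v 1 1) (v z 1))) :=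
      (tendsto_const_nhds).inner l4
    simp only [b.innv h, star_one, one_mul, orb_tr h (hs _)] at h1
    have h2 := tendsto_nhds_unique h1 tendsto_const_nhds
    rw [hc] at h2
    simpa [h.one] using h2
  rw [← hcτ, ← hc]
  exact l3
end


section
variable {A : Type u} [CStarAlgebra A] {τ : A →ₗ[ℂ] ℂ} {N : StarSubalgebra ℂ A} {E : A →ₗ[ℂ] A}
  {K : Type u} [NormedAddCommGroup K] [InnerProductSpace ℂ K] [CompleteSpace K]
  {v : A → A → K} {L R : A → K →L[ℂ] K}

theorem Setup.tEE (h : Setup τ N E) (x c : A) : τ (E x * c) = τ (x * E c) := by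
  rw [← h.tE (h.mem x), h.tE' (h.mem c)]

theorem tend_dense (O : Set K) (hO : Dense ((Submodule.span ℂ O : Submodule ℂ K) : Set K))
    (T : ℕ → K →L[ℂ] K) (C : ℝ) (hT : ∀ n k, ‖T n k‖ ≤ C * ‖k‖)
    (h0 : ∀ k ∈ O, Tendsto (fun n => T n k) atTop (nhds 0)) (κ : ℕ → K) (k : K)
    (hκ : Tendsto κ atTop (nhds k)) : Tendsto (fun n => T n (κ n)) atTop (nhds 0) := by
  have h1 : ∀ k ∈ (Submodule.span ℂ O : Submodule ℂ K), Tendsto (fun n => T n k) atTop (nhds 0) := by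
    intro k hk
    induction hk using Submodule.span_induction with
    | mem x hx => exact h0 x hx
    | zero => simp
    | add x y _ _ hx hy => simpa using hx.add hy
    | smul c x _ hx => simpa using hx.const_smul c
  rw [Metric.tendsto_atTop]
  intro ε hε
  obtain ⟨k', hk', hd⟩ := hO.exists_dist_lt k (ε := ε / (4 * (|C| + 1))) (by positivity)
  obtain ⟨n1, hn1⟩ := Metric.tendsto_atTop.mp (h1 k' hk') (ε / 2) (by positivity)
  obtain ⟨n2, hn2⟩ := Metric.tendsto_atTop.mp hκ (ε / (4 * (|C| + 1))) (by positivity)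
  refine ⟨max n1 n2, fun n hn => ?_⟩
  have a1 := hn1 n (le_of_max_le_left hn)
  have a2 := hn2 n (le_of_max_le_right hn)
  rw [dist_zero_right] at a1 ⊢
  have e : T n (κ n) = T n (κ n - k) + T n (k - k') + T n k' := by
    simp
  rw [dist_eq_norm] at a2 hd
  have hb : ∀ w : K, ‖w‖ < ε / (4 * (|C| + 1)) → ‖T n w‖ ≤ ε / 4 := fun w hw => by
    calc ‖T n w‖ ≤ C * ‖w‖ := hT n w
      _ ≤ (|C| + 1) * ‖w‖ := by gcongr; linarith [le_abs_self C]
      _ ≤ (|C| + 1) * (ε / (4 * (|C| + 1))) := by gcongr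
      _ = ε / 4 := by field_simp
  calc ‖T n (κ n)‖ ≤ ‖T n (κ n - k)‖ + ‖T n (k - k')‖ + ‖T n k'‖ := by rw [e]; exact norm_add₃_le
    _ < ε / 4 + ε / 4 + ε / 2 := by linarith [hb _ a2, hb _ hd]
    _ = ε := by ring

theorem tend_sq {f g : ℕ → ℝ} (h : ∀ n, f n ^ 2 ≤ g n) (hf : ∀ n, 0 ≤ f n) (hg : Tendsto g atTop (nhds 0)) :
    Tendsto f atTop (nhds 0) := by
  have := (Real.continuous_sqrt.tendsto 0).comp hg
  rw [Real.sqrt_zero] at this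
  exact squeeze_zero hf (fun n => Real.le_sqrt_of_sq_le (h n)) this

theorem IsBM.Lt (b : IsBM τ E v L R) (h : Setup τ N E) (S : ℕ → A) (C : ℝ) (hS : ∀ n, ‖S n‖ ≤ C)
    (h0 : Tendsto (fun n => v (S n) 1) atTop (nhds 0)) (κ : ℕ → K) (k : K)
    (hκ : Tendsto κ atTop (nhds k)) : Tendsto (fun n => L (S n) (κ n)) atTop (nhds 0) := by
  refine tend_dense _ b.dense (fun n => L (S n)) C (fun n k => (b.Ln _ _).trans (by gcongr; exact hS n)) ?_ κ k hκ
  rintro _ ⟨⟨a, c⟩, rfl⟩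
  simp only
  rw [tendsto_zero_iff_norm_tendsto_zero] at h0 ⊢
  let w := a * E (c * star c) * star a
  refine tend_sq (g := fun n => ‖v (S n) 1‖ * (C * ‖v w 1‖)) (fun n => ?_) (fun n => norm_nonneg _)
    (by simpa using h0.mul_const (C * ‖v w 1‖))
  have e : inner ℂ (L (S n) (v a c)) (L (S n) (v a c)) = inner ℂ (v (S n) 1) (L (S n) (v w 1)) := by
    rw [b.Lv, b.Lv, b.inn, b.innv h, mul_assoc, h.tr, mul_assoc, h.tEE, star_mul]
    simp only [mul_assoc]
    rw [h.tr]
    simp only [w, mul_assoc]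
  calc ‖L (S n) (v a c)‖ ^ 2 = ‖(inner ℂ (L (S n) (v a c)) (L (S n) (v a c)) : ℂ)‖ := by simp
    _ ≤ ‖v (S n) 1‖ * ‖L (S n) (v w 1)‖ := by rw [e]; exact norm_inner_le_norm _ _
    _ ≤ _ := by gcongr; exact (b.Ln _ _).trans (by gcongr; exact hS n)

theorem IsBM.Rt (b : IsBM τ E v L R) (h : Setup τ N E) (S : ℕ → A) (C : ℝ) (hS : ∀ n, ‖S n‖ ≤ C)
    (h0 : Tendsto (fun n => v (S n) 1) atTop (nhds 0)) (κ : ℕ → K) (k : K)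
    (hκ : Tendsto κ atTop (nhds k)) : Tendsto (fun n => R (S n) (κ n)) atTop (nhds 0) := by
  refine tend_dense _ b.dense (fun n => R (S n)) C (fun n k => (b.Rn _ _).trans (by gcongr; exact hS n)) ?_ κ k hκ
  rintro _ ⟨⟨a, c⟩, rfl⟩
  simp only
  rw [tendsto_zero_iff_norm_tendsto_zero] at h0 ⊢
  let w := star c * E (star a * a) * c
  refine tend_sq (g := fun n => ‖v (S n) 1‖ * (‖w‖ * ‖v (S n) 1‖)) (fun n => ?_) (fun n => norm_nonneg _)
    (by simpa using h0.mul (h0.const_mul ‖w‖))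
  have e : inner ℂ (R (S n) (v a c)) (R (S n) (v a c)) = inner ℂ (v (S n) 1) (L w (v (S n) 1)) := by
    rw [b.Lv, b.Rv, b.inn, b.innv h, star_mul]
    simp only [w, mul_assoc]
  calc ‖R (S n) (v a c)‖ ^ 2 = ‖(inner ℂ (R (S n) (v a c)) (R (S n) (v a c)) : ℂ)‖ := by simp
    _ ≤ ‖v (S n) 1‖ * ‖L w (v (S n) 1)‖ := by rw [e]; exact norm_inner_le_norm _ _
    _ ≤ _ := by gcongr; exact (b.Ln _ _)

theorem hull_pos {O : Set K} (k0 : K) (c : ℝ) (hO : ∀ k ∈ O, c ≤ (inner ℂ k0 k).re) :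
    ∀ k ∈ closure (convexHull ℝ O), c ≤ (inner ℂ k0 k).re := by
  let f : K →L[ℝ] ℝ := Complex.reCLM.comp ((innerSL ℂ k0).restrictScalars ℝ)
  have h1 : Convex ℝ (f ⁻¹' Set.Ici c) := (convex_Ici c).linear_preimage f.toLinearMap
  have h2 : IsClosed (f ⁻¹' Set.Ici c) := isClosed_Ici.preimage f.continuous
  intro k hk
  exact (closure_minimal (convexHull_min (fun k hk => hO k hk) h1) h2) hk

theorem IsBM.exη (b : IsBM τ E v L R) (h : Setup τ N E) (B : StarSubalgebra ℂ A)
    (hB : ∀ u ∈ unitary A, (∀ x ∈ B, x * u = u * x) → 1 / 2 ≤ (τ (star (E u) * E u)).re) :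
    ∃ η : K, η ≠ 0 ∧ (∀ x, (∀ y ∈ B, y * x = x * y) → L x η = R x η) ∧
      ∀ x, 0 ≤ (inner ℂ (L x (R (star x) η)) η).re := by
  let P := StarSubalgebra.centralizer ℂ (B : Set A)
  have hP : ∀ x, x ∈ P ↔ ∀ y ∈ B, y * x = x * y := fun x => by
    constructor
    · intro hx y hy
      exact ((StarSubalgebra.mem_centralizer_iff ℂ).mp hx y hy).1
    · intro hx
      exact (StarSubalgebra.mem_centralizer_iff ℂ).mpr fun y hy => ⟨hx y hy, hx _ (star_mem hy)⟩
  have hPc : IsClosed (P : Set A) := by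
    have : (P : Set A) = Set.centralizer (B : Set A) := by
      ext x
      rw [SetLike.mem_coe, hP, Set.mem_centralizer_iff]; rfl
    rw [this]; exact Set.isClosed_centralizer _
  let O : Set K := {k | ∃ u, u ∈ unitary A ∧ u ∈ P ∧ k = v u (star u)}
  obtain ⟨η, hη, hfix⟩ := fixed_pt (closure (convexHull ℝ O))
    (Set.Nonempty.closure (Set.Nonempty.mono (subset_convexHull ℝ _) ⟨_, 1, one_mem _, one_mem _, rfl⟩))
    isClosed_closure (convex_convexHull ℝ _).closure
    {f | ∃ u, u ∈ unitary A ∧ u ∈ P ∧ f = fun k => L u (R (star u) k)}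
    (by
      rintro _ ⟨u, hu, hN, rfl⟩
      constructor
      · intro x
        simp only
        rw [b.Lu (Unitary.mem_iff.mp hu).1, b.Ru h (by rw [star_star]; exact (Unitary.mem_iff.mp hu).1)]
      · intro x hx
        let g : K →L[ℝ] K := ((L u).comp (R (star u))).restrictScalars ℝ
        have h1 : g x ∈ g '' closure (convexHull ℝ O) := ⟨x, hx, rfl⟩
        refine closure_mono ?_ (image_closure_subset_closure_image g.continuous h1)
        have h2 := LinearMap.image_convexHull g.toLinearMap O
        refine subset_trans (subset_of_eq h2) (convexHull_mono ?_)
        rintro _ ⟨_, ⟨w, hw, hwN, rfl⟩, rfl⟩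
        refine ⟨u * w, mul_mem hu hw, mul_mem hN hwN, ?_⟩
        simp [g, b.Lv, b.Rv])
  refine ⟨η, ?_, ?_, ?_⟩
  · rintro rfl
    have := hull_pos (O := O) (v 1 1) (1 / 2) (by
      rintro _ ⟨u, hu, hN, rfl⟩
      have := hB u hu ((hP u).mp hN)
      convert this using 2
      rw [b.inn]
      simp only [star_one, one_mul]
      rw [← h.tE (h.mem u), h.estar, h.tr]) 0 hη
    norm_num at this
  · intro x hx
    have hx' := span_uni P hPc ((hP x).mpr hx)
    clear hx
    induction hx' using Submodule.span_induction with
    | mem u hu =>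
      have : L u (R (star u) η) = η := hfix _ ⟨u, hu.1, hu.2, rfl⟩
      conv_rhs => rw [← this]
      rw [← b.LR, ← b.Rm, (Unitary.mem_iff.mp hu.1).1, b.R1]
    | zero => rw [b.L0, b.R0]
    | add x y _ _ hx hy => rw [b.La, b.Ra, hx, hy]
    | smul c x _ hx => rw [b.Ls, b.Rs, hx]
  · intro x
    refine hull_pos (O := O) (L x (R (star x) η)) 0 ?_ η hη
    rintro _ ⟨w, hw, hwN, rfl⟩
    have e : ∀ k, (inner ℂ (L x (R (star x) k)) (v w (star w))).re =
        (inner ℂ (L (star x) (R x (v w (star w)))) k).re := fun k => by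
      rw [b.Ladj, b.Radj h, star_star, b.LR]
      exact inner_re_symm (𝕜 := ℂ) _ _
    rw [e]
    refine hull_pos (O := O) _ 0 ?_ η hη
    rintro _ ⟨u, hu, huN, rfl⟩
    rw [← e, b.Rv, b.Lv, b.inn]
    have e2 : τ (star (star u * star x) * E (star (x * u) * w) * star w) =
        τ (star (star (E (star w * x * u))) * star (E (star w * x * u))) := by
      rw [h.tr, ← mul_assoc, ← h.tE' (h.mem _), star_star, ← h.estar]
      congr 3 <;> simp [mul_assoc]
    rw [e2]
    exact (Complex.nonneg_iff.mp (h.pos _)).1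
end


section
variable {A : Type u} [CStarAlgebra A] {τ : A →ₗ[ℂ] ℂ} {N : StarSubalgebra ℂ A} {E : A →ₗ[ℂ] A}
  {K : Type u} [NormedAddCommGroup K] [InnerProductSpace ℂ K] [CompleteSpace K]
  {v : A → A → K} {L R : A → K →L[ℂ] K}

theorem exists_sub_proj (B : StarSubalgebra ℂ A) (hfd : FiniteDimensional ℂ B) (p : A)
    (x : A) (hx : x ∈ B) (hs : IsSelfAdjoint x) (hpx : p * x = x) (hxp : x * p = x)
    (hns : ∀ c : ℂ, x ≠ c • p) :
    ∃ q ∈ B, star q = q ∧ q * q = q ∧ p * q = q ∧ q * p = q ∧ q ≠ 0 ∧ q ≠ p := by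
  have hBc : IsClosed (B : Set A) := Submodule.closed_of_finiteDimensional (Subalgebra.toSubmodule B.toSubalgebra)
  have hfin : (spectrum ℝ x).Finite := by
    have : FiniteDimensional ℝ B := Module.Finite.trans ℂ B
    have h1 : IsIntegral ℝ (⟨x, hx⟩ : B) := Algebra.IsIntegral.isIntegral _
    obtain ⟨f, hf, hfx⟩ := h1
    have h2 : Polynomial.aeval x f = 0 := by
      have h3 : Polynomial.aeval (⟨x, hx⟩ : B) f = 0 := hfx
      have := congrArg (B.subtype.toAlgHom.restrictScalars ℝ) h3
      rw [← Polynomial.aeval_algHom_apply, map_zero] at this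
      exact this
    refine (Polynomial.finite_setOfPred_isRoot hf.ne_zero).subset fun t ht => ?_
    have h3 := spectrum.subset_polynomial_aeval x f ⟨t, ht, rfl⟩
    rw [h2] at h3
    have : Nontrivial A := by
      by_contra hn
      rw [not_nontrivial_iff_subsingleton] at hn
      exact hns 0 (Subsingleton.elim _ _)
    rw [spectrum.zero_eq] at h3
    exact h3
  have hct : ∀ f : ℝ → ℝ, ContinuousOn f (spectrum ℝ x) := fun f => hfin.continuousOn f
  obtain ⟨t, ht, ht0⟩ : ∃ t ∈ spectrum ℝ x, t ≠ 0 := by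
    by_contra! hcon
    apply hns 0
    rw [zero_smul]
    have : cfc (id : ℝ → ℝ) x = cfc (0 : ℝ → ℝ) x := cfc_congr fun t ht => hcon t ht
    rw [cfc_id ℝ x] at this
    rw [this]
    exact cfc_zero ℝ x
  let f : ℝ → ℝ := fun s => if s = t then 1 else 0
  let g : ℝ → ℝ := fun s => if s = t then t⁻¹ else 0
  have e1 : cfc f x * x = t • cfc f x := by
    have h1 : cfc f x * x = cfc (fun s => f s * id s) x := by
      rw [cfc_mul f id x (hct _) (hct _), cfc_id ℝ x]
    have h2 : t • cfc f x = cfc (fun s => t • f s) x := (cfc_smul t f x (hct _)).symm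
    rw [h1, h2]
    refine cfc_congr fun s _ => ?_
    by_cases hst : s = t <;> simp [f, hst]
  have e2 : x * cfc g x = cfc f x := by
    have h1 : x * cfc g x = cfc (fun s => id s * g s) x := by
      rw [cfc_mul id g x (hct _) (hct _), cfc_id ℝ x]
    rw [h1]
    refine cfc_congr fun s _ => ?_
    by_cases hst : s = t <;> simp [f, g, hst, ht0]
  have e3 : cfc g x * x = cfc f x := by
    have h1 : cfc g x * x = cfc (fun s => g s * id s) x := by
      rw [cfc_mul g id x (hct _) (hct _), cfc_id ℝ x]
    rw [h1]
    refine cfc_congr fun s _ => ?_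
    by_cases hst : s = t <;> simp [f, g, hst, ht0]
  refine ⟨cfc f x, cfc_mem (hs := hBc) f hx, (cfc_predicate f x : IsSelfAdjoint _), ?_, ?_, ?_, ?_, ?_⟩
  · rw [← cfc_mul f f x (hct _) (hct _)]
    refine cfc_congr fun s _ => ?_
    by_cases hst : s = t <;> simp [f, hst]
  · rw [← e2, ← mul_assoc, hpx]
  · rw [← e3, mul_assoc, hxp]
  · intro h0
    have h1 : f t ∈ spectrum ℝ (cfc f x) := by
      rw [cfc_map_spectrum f x hs (hct _)]; exact ⟨t, ht, rfl⟩
    have : Nontrivial A := by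
      by_contra hn
      rw [not_nontrivial_iff_subsingleton] at hn
      exact hns 0 (Subsingleton.elim _ _)
    rw [h0, spectrum.zero_eq] at h1
    simp [f] at h1
  · intro h0
    rw [h0, hpx] at e1
    exact hns t (by rw [e1, Complex.coe_smul])

def Wp (B : StarSubalgebra ℂ A) (p : A) : Submodule ℂ A where
  carrier := {b | b ∈ B ∧ p * b = b ∧ b * p = b}
  add_mem' := fun {a c} ha hc => ⟨add_mem ha.1 hc.1, by rw [mul_add, ha.2.1, hc.2.1], by rw [add_mul, ha.2.2, hc.2.2]⟩
  zero_mem' := ⟨zero_mem _, by simp, by simp⟩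
  smul_mem' := fun c x hx => ⟨SMulMemClass.smul_mem c hx.1, by rw [mul_smul_comm, hx.2.1], by rw [smul_mul_assoc, hx.2.2]⟩

theorem IsBM.exp (b : IsBM τ E v L R) (h : Setup τ N E) (B : StarSubalgebra ℂ A)
    (hfd : FiniteDimensional ℂ B) (η : K) (hη : η ≠ 0)
    (hpos : ∀ x, 0 ≤ (inner ℂ (L x (R (star x) η)) η).re) :
    ∃ p ∈ B, star p = p ∧ p * p = p ∧ L p (R p η) ≠ 0 ∧
      ∀ x ∈ B, p * x = x → x * p = x → ∃ c : ℂ, x = c • p := by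
  have hfdW : ∀ p, FiniteDimensional ℂ (Wp B p) := fun p => by
    have : FiniteDimensional ℂ (Subalgebra.toSubmodule B.toSubalgebra) := hfd
    exact Submodule.finiteDimensional_of_le (S₂ := Subalgebra.toSubmodule B.toSubalgebra) fun x hx => hx.1
  have key : ∀ n : ℕ, ∀ p ∈ B, star p = p → p * p = p → L p (R p η) ≠ 0 →
      Module.finrank ℂ (Wp B p) = n → 
      ∃ p ∈ B, star p = p ∧ p * p = p ∧ L p (R p η) ≠ 0 ∧
      ∀ x ∈ B, p * x = x → x * p = x → ∃ c : ℂ, x = c • p := by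
    intro n
    induction n using Nat.strong_induction_on with
    | _ n ih =>
    intro p hpB hps hpp hpη hn
    by_contra! hcon
    obtain ⟨x, hx, hpx, hxp, hxc⟩ := hcon p hpB hps hpp hpη
    have hsa : ∃ y ∈ B, IsSelfAdjoint y ∧ p * y = y ∧ y * p = y ∧ ∀ c : ℂ, y ≠ c • p := by
      have hpx' : p * star x = star x := by
        have := congrArg star hxp; rwa [star_mul, hps] at this
      have hxp' : star x * p = star x := by
        have := congrArg star hpx; rwa [star_mul, hps] at this
      by_contra! hcon
      obtain ⟨c, hc⟩ := hcon (x + star x) (add_mem hx (star_mem hx)) (IsSelfAdjoint.add_star_self x)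
        (by rw [mul_add, hpx, hpx']) (by rw [add_mul, hxp, hxp'])
      obtain ⟨d, hd⟩ := hcon (Complex.I • (x - star x)) (SMulMemClass.smul_mem _ (sub_mem hx (star_mem hx)))
        (by rw [IsSelfAdjoint, star_smul, star_sub, star_star]; simp [smul_sub]; abel)
        (by rw [mul_smul_comm, mul_sub, hpx, hpx']) (by rw [smul_mul_assoc, sub_mul, hxp, hxp'])
      apply hxc ((c - Complex.I * d) / 2)
      have : x = (1 / 2 : ℂ) • ((x + star x) - Complex.I • (Complex.I • (x - star x))) := by
        rw [smul_smul, Complex.I_mul_I]; module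
      rw [this, hc, hd]; module
    obtain ⟨y, hy, hys, hpy, hyp, hyc⟩ := hsa
    obtain ⟨q, hqB, hqs, hqq, hpq, hqp, hq0, hqne⟩ := exists_sub_proj B hfd p y hy hys hpy hyp hyc
    have dec : ∀ r ∈ B, star r = r → r * r = r → p * r = r → r * p = r → r ≠ p → L r (R r η) = 0 := by
      intro r hrB hrs hrr hpr hrp hne
      by_contra h0
      have hlt : Wp B r < Wp B p := by
        rw [SetLike.lt_iff_le_and_exists]
        refine ⟨fun z hz => ⟨hz.1, ?_, ?_⟩, p, ⟨hpB, hpp, hpp⟩, fun hz => hne ?_⟩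
        · rw [← hz.2.1, ← mul_assoc, hpr]
        · rw [← hz.2.2, mul_assoc, hrp]
        · have := hz.2.1; rw [hrp] at this; exact this
      have hl := Submodule.finrank_lt_finrank_of_lt hlt
      obtain ⟨p', h1, h2, h3, h4, h5⟩ := ih _ (hn ▸ hl) r hrB hrs hrr h0 rfl
      obtain ⟨x, h6, h7, h8, h9⟩ := hcon p' h1 h2 h3 h4
      obtain ⟨c, hc⟩ := h5 x h6 h7 h8
      exact h9 c hc
    have d1 := dec q hqB hqs hqq hpq hqp hqne
    have d2 := dec (p - q) (sub_mem hpB hqB) (by rw [star_sub, hps, hqs])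
      (by rw [mul_sub, sub_mul, sub_mul, hpp, hqp, hpq, hqq]; abel) (by rw [mul_sub, hpp, hpq])
      (by rw [sub_mul, hpp, hqp]) (fun h0 => hq0 (by simpa using h0))
    have d3 := hpos (q - (p - q))
    have hds : star (q - (p - q)) = q - (p - q) := by simp [hps, hqs]
    rw [hds] at d3
    have d4 : L (q - (p - q)) (R (q - (p - q)) η) = - L p (R p η) := by
      simp only [b.Lsub, b.Rsub, map_sub] at d1 d2 ⊢
      linear_combination (norm := module) (2 : ℂ) • d2 + (2 : ℂ) • d1
    rw [d4] at d3
    have d6 : inner ℂ (L p (R p η)) η = inner ℂ (L p (R p η)) (L p (R p η)) := by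
      have d5 : L p (R p (L p (R p η))) = L p (R p η) := by
        rw [← b.LR p p (R p η), ← b.Rm, hpp, ← b.Lm, hpp]
      rw [b.Ladj, b.Ladj, b.Radj h, b.Radj h, hps, ← b.LR, ← b.LR, d5]
    rw [inner_neg_left, d6, Complex.neg_re] at d3
    have d7 := inner_self_eq_norm_sq (𝕜 := ℂ) (L p (R p η))
    change (inner ℂ (L p (R p η)) (L p (R p η))).re = _ at d7
    rw [d7] at d3
    have : 0 < ‖L p (R p η)‖ := norm_pos_iff.mpr hpη
    nlinarith
  exact key _ 1 (one_mem _) (by simp) (by simp) (by rw [b.R1, b.L1]; exact hη) rfl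
end


section
variable {A : Type u} [CStarAlgebra A] {τ : A →ₗ[ℂ] ℂ} {N : StarSubalgebra ℂ A} {E : A →ₗ[ℂ] A}
  {K : Type u} [NormedAddCommGroup K] [InnerProductSpace ℂ K] [CompleteSpace K]
  {v : A → A → K} {L R : A → K →L[ℂ] K}

def Bp (B : StarSubalgebra ℂ A) (p : A) : Submodule ℂ A where
  carrier := {b | b ∈ B ∧ b * p = b}
  add_mem' := fun {a c} ha hc => ⟨add_mem ha.1 hc.1, by rw [add_mul, ha.2, hc.2]⟩
  zero_mem' := ⟨zero_mem _, by simp⟩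
  smul_mem' := fun c x hx => ⟨SMulMemClass.smul_mem c hx.1, by rw [smul_mul_assoc, hx.2]⟩

theorem IsBM.cen (b : IsBM τ E v L R) (h : Setup τ N E) (B : StarSubalgebra ℂ A)
    (hfd : FiniteDimensional ℂ B) (η : K)
    (hη : ∀ x, (∀ y ∈ B, y * x = x * y) → L x η = R x η)
    (p : A) (hpB : p ∈ B) (hps : star p = p) (hpp : p * p = p) (hp0 : p ≠ 0)
    (hmin : ∀ x ∈ B, p * x = x → x * p = x → ∃ c : ℂ, x = c • p)
    (x : A) (hpx : p * x = x) (hxp : x * p = x) :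
    L x (L p (R p η)) = R x (L p (R p η)) := by
  have hτ : τ p ≠ 0 := fun h0 => hp0 (h.faith p (by rw [hps, hpp, h0]))
  have hfdW : FiniteDimensional ℂ (Bp B p) := by
    have : FiniteDimensional ℂ (Subalgebra.toSubmodule B.toSubalgebra) := hfd
    exact Submodule.finiteDimensional_of_le (S₂ := Subalgebra.toSubmodule B.toSubalgebra) fun x hx => hx.1
  let f : A →ₗ[ℂ] K :=
    { toFun := fun a => v a 1, map_add' := fun x y => b.va x y 1, map_smul' := fun c x => b.vs c x 1 }
  let V := (Bp B p).map f
  let e := stdOrthonormalBasis ℂ V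
  have he : ∀ j, ∃ c ∈ Bp B p, v c 1 = e j := fun j => (e j).2
  choose c hc hce using he
  have hexp : ∀ a ∈ Bp B p, a = ∑ j, τ (star (c j) * a) • c j := by
    intro a ha
    apply b.vinj h
    have h1 := e.sum_repr' ⟨v a 1, ⟨a, ha, rfl⟩⟩
    have h2 := congrArg (Subtype.val) h1
    simp only [Submodule.coe_sum, Submodule.coe_smul, Submodule.coe_inner, ← hce, b.innv h] at h2
    rw [← h2]
    have h3 : v (∑ j, τ (star (c j) * a) • c j) 1 = f (∑ j, τ (star (c j) * a) • c j) := rfl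
    rw [h3, map_sum]
    simp only [map_smul]
    rfl
  have hcb : ∀ j, star (c j) * p = (τ (star (c j) * p) / τ p) • p := by
    intro j
    obtain ⟨m, hm⟩ := hmin (star (c j) * p) (mul_mem (star_mem (hc j).1) hpB)
      (by
        have := congrArg star (hc j).2
        rw [star_mul, hps] at this
        rw [← mul_assoc, this]) (by rw [mul_assoc, hpp])
    have h1 : τ (star (c j) * p) = m * τ p := by rw [hm, map_smul, smul_eq_mul]
    rw [h1, mul_div_cancel_right₀ _ hτ, hm]
  let T := τ p • ∑ j, c j * x * star (c j)
  have hT : ∀ y ∈ B, y * T = T * y := by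
    intro y hy
    have h1 : ∀ j, y * c j = ∑ i, τ (star (c i) * (y * c j)) • c i := fun j =>
      hexp _ ⟨mul_mem hy (hc j).1, by rw [mul_assoc, (hc j).2]⟩
    have h2 : ∀ j, star (c j) * y = ∑ i, τ (star (c j) * (y * c i)) • star (c i) := fun j => by
      have h3 := congrArg star (hexp (star y * c j) ⟨mul_mem (star_mem hy) (hc j).1, by rw [mul_assoc, (hc j).2]⟩)
      simp only [star_mul, star_star, star_sum, star_smul, ← h.tstar] at h3
      rw [h3]; simp only [mul_assoc]
    simp only [T, mul_smul_comm, smul_mul_assoc, Finset.mul_sum, Finset.sum_mul]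
    congr 1
    have h4 : ∀ j, y * (c j * x * star (c j)) = ∑ i, τ (star (c i) * (y * c j)) • (c i * x * star (c j)) := fun j => by
      conv_lhs => rw [← mul_assoc, ← mul_assoc, h1 j, Finset.sum_mul, Finset.sum_mul]
      simp
    have h5 : ∀ j, c j * x * star (c j) * y = ∑ i, τ (star (c j) * (y * c i)) • (c j * x * star (c i)) := fun j => by
      conv_lhs => rw [mul_assoc, h2 j, Finset.mul_sum]
      simp
    simp only [h4, h5]
    rw [Finset.sum_comm]
  have hTp : T * p = x := by
    have h1 : ∀ j, c j * x * star (c j) * p = (τ p)⁻¹ • ((τ (star (c j) * p) • c j) * x) := fun j => by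
      conv_lhs => rw [mul_assoc, hcb j, mul_smul_comm, mul_assoc, hxp]
      rw [smul_mul_assoc, smul_smul, div_eq_inv_mul]
    simp only [T, smul_mul_assoc, Finset.sum_mul, h1]
    rw [← Finset.smul_sum, smul_smul, mul_inv_cancel₀ hτ, one_smul]
    simp only [← smul_mul_assoc]
    rw [← Finset.sum_mul, ← hexp p ⟨hpB, hpp⟩, hpx]
  have hpT : p * T = x := by rw [hT p hpB, hTp]
  calc L x (L p (R p η)) = R p (L x η) := by rw [← b.Lm, hxp, b.LR]
    _ = L p (R x η) := by
      conv_lhs => rw [← hpT, b.Lm, hη T hT, ← b.LR, ← b.Rm, hTp]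
    _ = R x (L p (R p η)) := by rw [← b.LR, ← b.Rm, hpx]
end


section
variable {A : Type u} [CStarAlgebra A] {τ : A →ₗ[ℂ] ℂ} {N : StarSubalgebra ℂ A} {E : A →ₗ[ℂ] A}
  {K : Type u} [NormedAddCommGroup K] [InnerProductSpace ℂ K] [CompleteSpace K]
  {v : A → A → K} {L R : A → K →L[ℂ] K}

theorem hull_zero {O : Set (A × K)} {F : Type*} [AddCommGroup F] [Module ℂ F] (f : A × K →ₗ[ℂ] F)
    (hf : ∀ q ∈ O, f q = 0) :
    ∀ q ∈ convexHull ℝ O, f q = 0 := by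
  have h1 : Convex ℝ (((LinearMap.ker f).restrictScalars ℝ : Submodule ℝ (A × K)) : Set (A × K)) := Submodule.convex _
  intro q hq
  have := convexHull_min (s := O) (fun q hq => by simpa using hf q hq) h1 hq
  simpa using this

theorem IsBM.exζ (b : IsBM τ E v L R) (h : Setup τ N E) (p : A) (hpp : p * p = p)
    (hτ : τ p ≠ 0) (k : K) (hk : k ≠ 0) (hLk : L p k = k) (hRk : R p k = k)
    (hc : ∀ x, p * x = x → x * p = x → L x k = R x k) :
    ∃ ζ : K, ζ ≠ 0 ∧ ∀ x, L x ζ = R x ζ := by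
  obtain ⟨s, ζ, hs, hS, hκ⟩ := b.avg h p k
  have hc' : ∀ y, L (p * y * p) k = R (p * y * p) k := fun y => hc _
    (by rw [← mul_assoc, ← mul_assoc, hpp]) (by rw [mul_assoc, hpp])
  have g1 : ∀ x, ∀ q ∈ orb N L R p k, ∀ r ∈ orb N L R p k,
      L q.1 (L x r.2) = R r.1 (R x q.2) := by
    rintro x _ ⟨u, hu, -, rfl⟩ _ ⟨w, hw, -, rfl⟩
    have e1 : L (u * p * star u) (L x (L w (R (star w) k))) = R (star w) (L u (L (p * (star u * x * w) * p) k)) := by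
      simp only [b.Lm, b.LR, hLk]
    have e2 : R (w * p * star w) (R x (L u (R (star u) k))) = R (star w) (L u (R (p * (star u * x * w) * p) k)) := by
      simp only [b.Rm, b.LR, hRk]
    simp only []
    rw [e1, e2, hc']
  have g2 : ∀ x, ∀ q ∈ convexHull ℝ (orb N L R p k), ∀ r ∈ orb N L R p k,
      L q.1 (L x r.2) = R r.1 (R x q.2) := by
    intro x q hq r hr
    let f : A × K →ₗ[ℂ] K :=
      { toFun := fun q => L q.1 (L x r.2) - R r.1 (R x q.2)
        map_add' := fun q q' => by simp [b.La]; abel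
        map_smul' := fun c q => by simp [b.Ls, smul_sub] }
    exact sub_eq_zero.mp (hull_zero f (fun q hq => sub_eq_zero.mpr (g1 x q hq r hr)) q hq)
  have g3 : ∀ x, ∀ q ∈ convexHull ℝ (orb N L R p k), ∀ r ∈ convexHull ℝ (orb N L R p k),
      L q.1 (L x r.2) = R r.1 (R x q.2) := by
    intro x q hq r hr
    let f : A × K →ₗ[ℂ] K :=
      { toFun := fun r => L q.1 (L x r.2) - R r.1 (R x q.2)
        map_add' := fun q q' => by simp [b.Ra]; abel
        map_smul' := fun c q => by simp [b.Rs, smul_sub] }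
    exact sub_eq_zero.mp (hull_zero f (fun r hr => sub_eq_zero.mpr (g2 x q hq r hr)) r hr)
  have g4 : ∀ r ∈ convexHull ℝ (orb N L R p k), L p (R p r.2) = L p (L r.1 k) := by
    intro r hr
    let f : A × K →ₗ[ℂ] K :=
      { toFun := fun r => L p (R p r.2) - L p (L r.1 k)
        map_add' := fun q q' => by simp [b.La]; abel
        map_smul' := fun c q => by simp [b.Ls, smul_sub] }
    refine sub_eq_zero.mp (hull_zero f (fun r hr => sub_eq_zero.mpr ?_) r hr)
    obtain ⟨u, hu, -, rfl⟩ := hr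
    have e1 : L p (R p (L u (R (star u) k))) = L p (L u (R (p * star u * p) k)) := by
      simp only [b.Rm, b.LR, hRk]
    simp only []
    rw [e1, ← hc']
    simp only [b.Lm, hLk]
  have hn : ∀ n, ‖(s n).1 - τ p • 1‖ ≤ ‖p‖ + ‖τ p • (1 : A)‖ := fun n =>
    (norm_sub_le _ _).trans (by gcongr; exact orb_norm (hs n))
  have lL : ∀ (κ : ℕ → K) (l : K), Tendsto κ atTop (nhds l) →
      Tendsto (fun n => L (s n).1 (κ n)) atTop (nhds (τ p • l)) := by
    intro κ l hl
    have := (b.Lt h (fun n => (s n).1 - τ p • 1) _ hn hS κ l hl).add (hl.const_smul (τ p))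
    rw [zero_add] at this
    refine this.congr fun n => ?_
    rw [b.Lsub, b.Ls, b.L1, sub_add_cancel]
  have lR : ∀ (κ : ℕ → K) (l : K), Tendsto κ atTop (nhds l) →
      Tendsto (fun n => R (s n).1 (κ n)) atTop (nhds (τ p • l)) := by
    intro κ l hl
    have := (b.Rt h (fun n => (s n).1 - τ p • 1) _ hn hS κ l hl).add (hl.const_smul (τ p))
    rw [zero_add] at this
    refine this.congr fun n => ?_
    rw [b.Rsub, b.Rs, b.R1, sub_add_cancel]
  refine ⟨ζ, ?_, fun x => ?_⟩
  · rintro rfl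
    have l1 := (((L p).continuous.comp (R p).continuous).tendsto 0).comp hκ
    have l2 := ((L p).continuous.tendsto _).comp (lL (fun _ => k) k tendsto_const_nhds)
    have l3 := tendsto_nhds_unique (l1.congr fun n => g4 _ (hs n)) l2
    simp only [Function.comp, map_zero, map_smul, hLk] at l3
    exact smul_ne_zero hτ hk l3.symm
  · have l1 := lL _ _ (((L x).continuous.tendsto ζ).comp hκ)
    have l2 := lR _ _ (((R x).continuous.tendsto ζ).comp hκ)
    have l3 := tendsto_nhds_unique (l1.congr fun n => g3 x _ (hs n) _ (hs n)) l2
    exact smul_right_injective K hτ l3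
end


section
variable {A : Type u} [CStarAlgebra A] {τ : A →ₗ[ℂ] ℂ} {N : StarSubalgebra ℂ A} {E : A →ₗ[ℂ] A}
  {K : Type u} [NormedAddCommGroup K] [InnerProductSpace ℂ K] [CompleteSpace K]
  {v : A → A → K} {L R : A → K →L[ℂ] K}

theorem IsBM.inv_eq (b : IsBM τ E v L R) (h : Setup τ N E) (φ : A →ₗ[ℂ] ℂ)
    (hφ : ∀ (S : ℕ → A) (C : ℝ), (∀ n, ‖S n‖ ≤ C) → Tendsto (fun n => v (S n) 1) atTop (nhds 0) →
      Tendsto (fun n => φ (S n)) atTop (nhds 0))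
    (hi : ∀ u ∈ unitary A, u ∈ N → ∀ y, φ (u * y * star u) = φ y) (y : A) :
    φ y = τ y * φ 1 := by
  obtain ⟨s, -, hs, hS, -⟩ := b.avg h y (0 : K)
  have hn : ∀ n, ‖(s n).1 - τ y • 1‖ ≤ ‖y‖ + ‖τ y • (1 : A)‖ := fun n =>
    (norm_sub_le _ _).trans (by gcongr; exact orb_norm (hs n))
  have g : ∀ n, φ (s n).1 = φ y := by
    intro n
    have h1 : Convex ℝ {p : A × K | φ p.1 = φ y} := by
      have := (convex_singleton (φ y)).linear_preimage ((φ.restrictScalars ℝ) ∘ₗ (LinearMap.fst ℝ A K))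
      exact this
    refine (convexHull_min ?_ h1) (hs n)
    rintro _ ⟨u, hu, hN, rfl⟩
    exact hi u hu hN y
  have l := hφ _ _ hn hS
  simp only [map_sub, map_smul, g, smul_eq_mul] at l
  exact sub_eq_zero.mp (tendsto_nhds_unique tendsto_const_nhds l)

theorem IsBM.bound (b : IsBM τ E v L R) (h : Setup τ N E) (ζ : K) (hζ : ζ ≠ 0)
    (hc : ∀ x, L x ζ = R x ζ) : ∃ C : ℝ, 0 < C ∧ ∀ a c : A,
      (τ (star (a * c) * (a * c))).re ≤ C * (τ (star c * E (star a * a) * c)).re := by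
  let ψ : A →ₗ[ℂ] ℂ :=
    { toFun := fun y => inner ℂ ζ (v y 1)
      map_add' := fun x y => by rw [b.va, inner_add_right]
      map_smul' := fun c x => by rw [b.vs, inner_smul_right]; rfl }
  have hψ : ∀ y, inner ℂ ζ (v y 1) = τ y * ψ 1 := b.inv_eq h ψ
    (fun S C _ hS => by
      have : Tendsto (fun n => inner ℂ ζ (v (S n) 1)) atTop (nhds (inner ℂ ζ 0)) := tendsto_const_nhds.inner hS
      rw [inner_zero_right] at this
      exact this)
    (fun u hu hN y => by
      change inner ℂ ζ (v (u * y * star u) 1) = inner ℂ ζ (v y 1)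
      have e : v (u * y * star u) 1 = L u (R (star u) (v y 1)) := by
        rw [b.Rv, b.Lv, b.vN h (star_mem hN)]; simp
      rw [e, ← star_star u, ← b.Ladj, star_star, hc, ← b.Radj h, ← b.Rm, (Unitary.mem_iff.mp hu).1, b.R1])
  let φ : A →ₗ[ℂ] ℂ :=
    { toFun := fun y => inner ℂ ζ (L y ζ)
      map_add' := fun x y => by rw [b.La, inner_add_right]
      map_smul' := fun c x => by rw [b.Ls, inner_smul_right]; rfl }
  have hφ : ∀ y, inner ℂ ζ (L y ζ) = τ y * φ 1 := b.inv_eq h φ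
    (fun S C hC hS => by
      have : Tendsto (fun n => inner ℂ ζ (L (S n) ζ)) atTop (nhds (inner ℂ ζ 0)) :=
        tendsto_const_nhds.inner (b.Lt h S C hC hS (fun _ => ζ) ζ tendsto_const_nhds)
      rw [inner_zero_right] at this
      exact this)
    (fun u hu hN y => by
      change inner ℂ ζ (L (u * y * star u) ζ) = inner ℂ ζ (L y ζ)
      rw [b.Lm, b.Lm, hc (star u), b.LR]
      rw [← star_star u, ← b.Ladj, star_star, hc, b.Radj h, star_star, ← b.Rm, (Unitary.mem_iff.mp hu).1, b.R1])
  have hφ1 : φ 1 = ((‖ζ‖ ^ 2 : ℝ) : ℂ) := by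
    change inner ℂ ζ (L 1 ζ) = _
    rw [b.L1, inner_self_eq_norm_sq_to_K]; simp
  have hL : ∀ m, ‖L m ζ‖ ^ 2 = ‖ζ‖ ^ 2 * (τ (star m * m)).re := by
    intro m
    rw [← inner_self_eq_norm_sq (𝕜 := ℂ), b.Ladj, ← b.Lm, hφ, hφ1]
    change (_ * _ : ℂ).re = _
    rw [mul_comm, Complex.re_ofReal_mul]
  have hv : ∀ a c, inner ℂ ζ (v a c) = τ (c * a) * ψ 1 := by
    intro a c
    rw [← hψ, ← b.Lv, ← star_star c, ← b.Ladj, hc, b.Radj h, b.Rv, star_star, one_mul]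
  have hlam : ψ 1 ≠ 0 := by
    intro h0
    apply hζ
    refine b.vext fun x y => ?_
    rw [inner_zero_right, ← inner_conj_symm, hv, h0]; simp
  refine ⟨‖ζ‖ ^ 2 / ‖ψ 1‖ ^ 2, by positivity, fun a c => ?_⟩
  set t := (τ (star (a * c) * (a * c))).re with ht
  set V := (τ (star c * E (star a * a) * c)).re with hV
  have ht0 : 0 ≤ t := (Complex.nonneg_iff.mp (h.pos _)).1
  have htt : τ (star (a * c) * (a * c)) = (t : ℂ) := by
    apply Complex.ext
    · simp [ht]
    · simpa using (Complex.nonneg_iff.mp (h.pos (a * c))).2.symm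
  have h1 : inner ℂ (L (a * c) ζ) (v a c) = t * ψ 1 := by
    rw [b.Ladj, b.Lv, hv, ← htt, ← mul_assoc, h.tr (c * _), ← mul_assoc, h.tr]
  have h2 : ‖v a c‖ ^ 2 = V := by
    rw [← inner_self_eq_norm_sq (𝕜 := ℂ), b.inn]; rfl
  have h3 := norm_inner_le_norm (𝕜 := ℂ) (L (a * c) ζ) (v a c)
  rw [h1, norm_mul, Complex.norm_real, Real.norm_of_nonneg ht0] at h3
  have h4 : (t * ‖ψ 1‖) ^ 2 ≤ (‖L (a * c) ζ‖ * ‖v a c‖) ^ 2 := by gcongr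
  rw [mul_pow, mul_pow, hL, h2, ← ht] at h4
  have hp : 0 < ‖ψ 1‖ ^ 2 := by positivity
  rw [div_mul_eq_mul_div, le_div_iff₀ hp]
  rcases ht0.eq_or_lt with h0 | h0
  · rw [← h0, zero_mul]; rw [← h2]; positivity
  · nlinarith

theorem Setup.main (h : Setup τ N E) (B : StarSubalgebra ℂ A) (hfd : FiniteDimensional ℂ B)
    (hB : ∀ u ∈ unitary A, (∀ x ∈ B, x * u = u * x) → 1 / 2 ≤ (τ (star (E u) * E u)).re) :
    ∃ C : ℝ, 0 < C ∧ ∀ a : A, ∃ S : A, (C : ℂ) • E (star a * a) - star a * a = star S * S := by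
  obtain ⟨K, i1, i2, i3, v, L, R, b⟩ := h.exBM
  obtain ⟨η, h0, h1, h2⟩ := b.exη h B hB
  obtain ⟨p, hpB, hps, hpp, hk, hmin⟩ := b.exp h B hfd η h0 h2
  have hp0 : p ≠ 0 := by
    rintro rfl
    exact hk (b.L0 _)
  have hτ : τ p ≠ 0 := fun h0 => hp0 (h.faith p (by rw [hps, hpp, h0]))
  obtain ⟨ζ, hζ, hc⟩ := b.exζ h p hpp hτ (L p (R p η)) hk (by rw [← b.Lm, hpp])
    (by rw [← b.LR, ← b.Rm, hpp]) (fun x hpx hxp => b.cen h B hfd η h1 p hpB hps hpp hp0 hmin x hpx hxp)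
  obtain ⟨C, hC, hb⟩ := b.bound h ζ hζ hc
  refine ⟨C, hC, fun a => ?_⟩
  obtain ⟨S, Y, W, e1, e2, e3, e4⟩ := neg_part ((C : ℂ) • E (star a * a) - star a * a) (by
    rw [IsSelfAdjoint, star_sub, star_smul, ← h.estar]; simp)
  refine ⟨S, ?_⟩
  have hY : Y = 0 := by
    apply cube_zero Y W e4 e2
    apply h.faith
    have h3 := hb a Y
    have h4 : star Y * ((C : ℂ) • E (star a * a) - star a * a) * Y = - (star (W * Y) * (W * Y)) := by
      rw [mul_assoc, e3, star_mul, e4]; nth_rewrite 2 [e2]; noncomm_ring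
    have h5 : star Y * ((C : ℂ) • E (star a * a) - star a * a) * Y =
      (C : ℂ) • (star Y * E (star a * a) * Y) - star (a * Y) * (a * Y) := by
      rw [mul_sub, sub_mul, star_mul]; simp [mul_assoc]
    have h6 := congrArg (fun x => (τ x).re) (h5.symm.trans h4)
    simp only [map_sub, map_smul, map_neg, smul_eq_mul, Complex.sub_re, Complex.re_ofReal_mul, Complex.neg_re] at h6
    have h7 := Complex.nonneg_iff.mp (h.pos (W * Y))
    apply Complex.ext
    · simp only [Complex.zero_re]; linarith
    · exact h7.2.symm
  rw [e1, hY, sub_zero]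
end


section
variable {A : Type*} [CStarAlgebra A] [PartialOrder A] [StarOrderedRing A]

noncomputable def ff (s : A) : A := cfc (fun t : ℝ => 1 - (1 + t)⁻¹) s

theorem spec_bd {s : A} (hs : 0 ≤ s) {t : ℝ} (ht : t ∈ spectrum ℝ s) : 0 ≤ t ∧ t ≤ ‖s‖ := by
  refine ⟨spectrum_nonneg_of_nonneg hs ht, ?_⟩
  have h := spectrum.subset_closedBall_norm_mul (𝕜 := ℝ) s ht
  rcases subsingleton_or_nontrivial A with hh | hh
  · simp at ht
  · simp at h
    exact (le_abs_self t).trans h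

theorem ff_cont {s : A} (hs : 0 ≤ s) : ContinuousOn (fun t : ℝ => 1 - (1 + t)⁻¹) (spectrum ℝ s) := by
  refine continuousOn_const.sub ((continuousOn_const.add continuousOn_id).inv₀ fun t ht => ?_)
  have := (spec_bd hs ht).1
  change (1 : ℝ) + t ≠ 0
  positivity

theorem ff_nonneg {s : A} (hs : 0 ≤ s) : 0 ≤ ff s := by
  refine cfc_nonneg fun t ht => ?_
  have := (spec_bd hs ht).1
  have : (1 + t)⁻¹ ≤ 1 := inv_le_one_of_one_le₀ (by linarith)
  linarith

theorem ff_norm {s : A} (hs : 0 ≤ s) : ‖ff s‖ ≤ 1 := by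
  refine norm_cfc_le zero_le_one fun t ht => ?_
  have := (spec_bd hs ht).1
  have h1 : (1 + t)⁻¹ ≤ 1 := inv_le_one_of_one_le₀ (by linarith)
  have h2 : 0 ≤ (1 + t)⁻¹ := by positivity
  rw [Real.norm_eq_abs, abs_le]
  constructor <;> linarith

theorem ff_mono {s t : A} (hs : 0 ≤ s) (h : s ≤ t) : ff s ≤ ff t := by
  have ht := hs.trans h
  have := CFC.monotoneOn_one_sub_one_add_inv_real (A := A) hs ht h
  rw [cfcₙ_eq_cfc (hf := by
      rw [quasispectrum_eq_spectrum_union_zero]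
      refine continuousOn_const.sub ((continuousOn_const.add continuousOn_id).inv₀ fun t ht => ?_)
      rcases ht with ht | ht
      · have := (spec_bd hs ht).1
        change (1 : ℝ) + t ≠ 0
        positivity
      · simp_all) (by simp),
    cfcₙ_eq_cfc (hf := by
      rw [quasispectrum_eq_spectrum_union_zero]
      refine continuousOn_const.sub ((continuousOn_const.add continuousOn_id).inv₀ fun t' ht' => ?_)
      rcases ht' with ht' | ht'
      · have := (spec_bd ht ht').1
        change (1 : ℝ) + t' ≠ 0
        positivity
      · simp_all) (by simp)] at this
  exact this

theorem ff_le {s : A} (hs : 0 ≤ s) : ff s ≤ s := by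
  conv_rhs => rw [← cfc_id ℝ s (IsSelfAdjoint.of_nonneg hs)]
  refine cfc_mono (hf := ff_cont hs) fun t ht => ?_
  have := (spec_bd hs ht).1
  simp only [id]
  have h1 : (1 + t) * (1 + t)⁻¹ = 1 := mul_inv_cancel₀ (by positivity)
  have h2 : 0 ≤ (1 + t)⁻¹ := by positivity
  nlinarith

theorem ff_ge {s : A} (hs : 0 ≤ s) {c : ℝ} (hc : ‖s‖ ≤ c) : s ≤ (1 + c) • ff s := by
  conv_lhs => rw [← cfc_id ℝ s (IsSelfAdjoint.of_nonneg hs)]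
  rw [ff, ← cfc_smul (1 + c) (fun t : ℝ => 1 - (1 + t)⁻¹) s (ff_cont hs)]
  refine cfc_mono (hg := by have := (ff_cont hs).const_smul (1 + c); exact this) fun t ht => ?_
  have h0 := (spec_bd hs ht)
  simp only [id, smul_eq_mul]
  have h0' := h0.1
  have h1 : (1 + t) * (1 + t)⁻¹ = 1 := mul_inv_cancel₀ (by positivity)
  have h2 : 0 ≤ (1 + t)⁻¹ := by positivity
  have h3 : 1 - (1 + t)⁻¹ = t * (1 + t)⁻¹ := by linarith
  rw [h3]
  have h4 : 0 ≤ t * (1 + t)⁻¹ := by positivity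
  have h5 : t ≤ c := h0.2.trans hc
  nlinarith

theorem sq_add_le (a b : A) : star (a + b) * (a + b) ≤ (2 : ℝ) • (star a * a) + (2 : ℝ) • (star b * b) := by
  rw [← sub_nonneg]
  have : (2 : ℝ) • (star a * a) + (2 : ℝ) • (star b * b) - star (a + b) * (a + b) = star (a - b) * (a - b) := by
    rw [two_smul, two_smul, star_add, star_sub]; noncomm_ring
  rw [this]; exact star_mul_self_nonneg _

theorem tele (y : ℕ → A) (k m : ℕ) (hkm : k ≤ m) :
    (2 : ℝ) ^ k • (star (y k - y m) * (y k - y m)) ≤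
      ∑ j ∈ Finset.Ico k m, (2 : ℝ) ^ (j + 1) • (star (y j - y (j + 1)) * (y j - y (j + 1))) := by
  induction hkm using Nat.decreasingInduction with
  | self => simp
  | of_succ k hk ih =>
    rw [Finset.sum_eq_sum_Ico_succ_bot hk]
    have h1 := sq_add_le (y k - y (k + 1)) (y (k + 1) - y m)
    rw [sub_add_sub_cancel] at h1
    have h2 : (2 : ℝ) ^ k • (star (y k - y m) * (y k - y m)) ≤ (2 : ℝ) ^ k •
      ((2 : ℝ) • (star (y k - y (k+1)) * (y k - y (k+1))) + (2 : ℝ) • (star (y (k+1) - y m) * (y (k+1) - y m))) :=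
      smul_le_smul_of_nonneg_left h1 (by positivity)
    rw [smul_add, smul_smul, smul_smul, ← pow_succ] at h2
    exact h2.trans (by gcongr)

end


section
variable {H : Type u} [NormedAddCommGroup H] [InnerProductSpace ℂ H] [CompleteSpace H]

theorem vn_closed (M : VonNeumannAlgebra H) : IsClosed (M : Set (Op H)) := by
  rw [← M.centralizer_centralizer]
  exact Set.isClosed_centralizer _

theorem vn_smul (M : VonNeumannAlgebra H) (c : ℂ) {x : Op H} (hx : x ∈ M) : c • x ∈ M :=
  (SMulMemClass.smul_mem c (show x ∈ M.toStarSubalgebra from hx) : c • x ∈ M.toStarSubalgebra)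

theorem vn_rsmul (M : VonNeumannAlgebra H) (c : ℝ) {x : Op H} (hx : x ∈ M) : c • x ∈ M := by
  rw [← Complex.coe_smul]; exact vn_smul M _ hx

theorem vn_cfc (M : VonNeumannAlgebra H) (f : ℝ → ℝ) {x : Op H} (hx : x ∈ M) : cfc f x ∈ M :=
  have : IsClosed (M.toStarSubalgebra : Set (Op H)) := vn_closed M
  (cfc_mem (𝕜' := ℂ) (s := M.toStarSubalgebra) f (show x ∈ M.toStarSubalgebra from hx) : cfc f x ∈ M.toStarSubalgebra)

theorem vn_sqrt (M : VonNeumannAlgebra H) {x : Op H} (hx : x ∈ M) (h0 : 0 ≤ x) :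
    ∃ a ∈ M, x = star a * a := by
  have hsa : IsSelfAdjoint (cfc (fun t : ℝ => Real.sqrt t) x) := cfc_predicate _ x
  refine ⟨cfc (fun t : ℝ => Real.sqrt t) x, vn_cfc M _ hx, ?_⟩
  rw [hsa.star_eq, ← cfc_mul (fun t : ℝ => Real.sqrt t) (fun t : ℝ => Real.sqrt t) x]
  conv_lhs => rw [← cfc_id ℝ x (IsSelfAdjoint.of_nonneg h0)]
  refine cfc_congr fun t ht => ?_
  exact (Real.mul_self_sqrt (spec_bd h0 ht).1).symm

theorem vn_sot (M : VonNeumannAlgebra H) {x : ℕ → Op H} {y : Op H} (hx : ∀ n, x n ∈ M)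
    (h : ∀ ξ, Tendsto (fun n => x n ξ) atTop (nhds (y ξ))) : y ∈ M := by
  change y ∈ (M : Set (Op H))
  rw [← M.centralizer_centralizer]
  intro t ht
  ext ξ
  have h1 : Tendsto (fun n => t (x n ξ)) atTop (nhds (t (y ξ))) := (t.continuous.tendsto _).comp (h ξ)
  have h2 := h (t ξ)
  refine tendsto_nhds_unique h1 (h2.congr fun n => ?_)
  have := ht (x n) (hx n)
  exact congrArg (fun T : Op H => T ξ) this

theorem sot_lim {x : ℕ → Op H} (h : ∀ ξ, CauchySeq (fun n => x n ξ)) :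
    ∃ y : Op H, ∀ ξ, Tendsto (fun n => x n ξ) atTop (nhds (y ξ)) := by
  choose f hf using fun ξ => cauchySeq_tendsto_of_complete (h ξ)
  have hf' : Tendsto (fun n ξ => x n ξ) atTop (nhds f) := tendsto_pi_nhds.mpr hf
  exact ⟨continuousLinearMapOfTendsto x hf', hf⟩

theorem tr_nonneg {M : VonNeumannAlgebra H} {τ : Op H →ₗ[ℂ] ℂ} (hT : IsTracialState (M : Set (Op H)) τ)
    {x : Op H} (hx : x ∈ M) (h0 : 0 ≤ x) : 0 ≤ τ x := by
  obtain ⟨a, ha, rfl⟩ := vn_sqrt M hx h0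
  exact hT.pos a ha

theorem tr_mono {M : VonNeumannAlgebra H} {τ : Op H →ₗ[ℂ] ℂ} (hT : IsTracialState (M : Set (Op H)) τ)
    {x y : Op H} (hx : x ∈ M) (hy : y ∈ M) (h0 : x ≤ y) : (τ x).re ≤ (τ y).re := by
  have := (Complex.nonneg_iff.mp (tr_nonneg hT (sub_mem hy hx) (sub_nonneg.mpr h0))).1
  rw [map_sub, Complex.sub_re] at this
  linarith

theorem tr_rsmul {τ : Op H →ₗ[ℂ] ℂ} (c : ℝ) (x : Op H) : (τ (c • x)).re = c * (τ x).re := by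
  rw [← Complex.coe_smul, map_smul, smul_eq_mul, Complex.re_ofReal_mul]

theorem tr_zero {M : VonNeumannAlgebra H} {τ : Op H →ₗ[ℂ] ℂ} (hT : IsTracialState (M : Set (Op H)) τ)
    {x : Op H} (hx : x ∈ M) (h0 : 0 ≤ x) (h1 : (τ x).re ≤ 0) : x = 0 := by
  have h2 := Complex.nonneg_iff.mp (tr_nonneg hT hx h0)
  obtain ⟨a, ha, rfl⟩ := vn_sqrt M hx h0
  rw [hT.faithful a ha (Complex.ext (le_antisymm h1 h2.1) h2.2.symm)]; simp

variable {ω : Ultrafilter ℕ} {M Mω : VonNeumannAlgebra H} {τ : Op H →ₗ[ℂ] ℂ} {limω : (ℕ → Op H) → Op H}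

theorem ev_ω (hω : IsFreeUltrafilter ω) (n₀ : ℕ) : ∀ᶠ n in (ω : Filter ℕ), n₀ ≤ n := by
  have h := hω (Set.Iio n₀) (Set.finite_Iio n₀)
  have h2 := Ultrafilter.compl_mem_iff_notMem.mpr h
  filter_upwards [h2] with n hn
  simpa using hn

theorem lim_sub (hU : IsTracialUltrapower ω M Mω τ limω) {x y : ℕ → Op H}
    (hx : SeqIn (M : Set (Op H)) x) (hbx : Bdd x) (hy : SeqIn (M : Set (Op H)) y) (hby : Bdd y) :
    limω (fun n => x n - y n) = limω x - limω y := by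
  have h1 : SeqIn (M : Set (Op H)) (fun n => (-1 : ℂ) • y n) := fun n => vn_smul M _ (hy n)
  have h2 : Bdd (fun n => (-1 : ℂ) • y n) := by
    obtain ⟨C, hC⟩ := hby
    exact ⟨C, fun n => by simpa using hC n⟩
  have := hU.map_add x _ hx hbx h1 h2
  rw [hU.map_smul _ y hy hby] at this
  simpa [sub_eq_add_neg] using this

theorem bdd_sub {x y : ℕ → Op H} (hbx : Bdd x) (hby : Bdd y) : Bdd (fun n => x n - y n) := by
  obtain ⟨C, hC⟩ := hbx
  obtain ⟨D, hD⟩ := hby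
  exact ⟨C + D, fun n => (norm_sub_le _ _).trans (add_le_add (hC n) (hD n))⟩

theorem lim_congr (hω : IsFreeUltrafilter ω) (hU : IsTracialUltrapower ω M Mω τ limω) {x y : ℕ → Op H}
    (hx : SeqIn (M : Set (Op H)) x) (hbx : Bdd x) (hy : SeqIn (M : Set (Op H)) y) (hby : Bdd y)
    (n₀ : ℕ) (h : ∀ n ≥ n₀, x n = y n) : limω x = limω y := by
  rw [← sub_eq_zero, ← lim_sub hU hx hbx hy hby,
    hU.eq_zero _ (fun n => sub_mem (hx n) (hy n)) (bdd_sub hbx hby)]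
  refine tendsto_const_nhds.congr' ?_
  filter_upwards [ev_ω hω n₀] with n hn
  rw [h n hn]; simp

theorem lim_nonneg (hω : IsFreeUltrafilter ω) (hU : IsTracialUltrapower ω M Mω τ limω) {x : ℕ → Op H}
    (hx : SeqIn (M : Set (Op H)) x) (hbx : Bdd x) (n₀ : ℕ) (h : ∀ n ≥ n₀, 0 ≤ x n) : 0 ≤ limω x := by
  obtain ⟨C, hC⟩ := hbx
  have hC0 : 0 ≤ C := (norm_nonneg _).trans (hC 0)
  have h1 : ∀ n, ∃ a ∈ M, (if n₀ ≤ n then x n else 0) = star a * a := by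
    intro n
    split_ifs with hn
    · exact vn_sqrt M (hx n) (h n hn)
    · exact ⟨0, zero_mem _, by simp⟩
  choose a ha hxa using h1
  have hab : Bdd a := by
    refine ⟨Real.sqrt C, fun n => Real.le_sqrt_of_sq_le ?_⟩
    rw [sq, ← CStarRing.norm_star_mul_self, ← hxa]
    split_ifs
    · exact hC n
    · simpa using hC0
  have hab' : Bdd (fun n => star (a n)) := by
    obtain ⟨D, hD⟩ := hab
    exact ⟨D, fun n => by rw [norm_star]; exact hD n⟩
  have hs : SeqIn (M : Set (Op H)) (fun n => star (a n)) := fun n => star_mem (ha n)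
  have h2 := hU.map_mul _ a hs hab' ha hab
  rw [hU.map_star a ha hab] at h2
  have h3 : limω x = limω (fun n => star (a n) * a n) := by
    refine lim_congr hω hU hx ⟨C, hC⟩ (fun n => mul_mem (hs n) (ha n)) ⟨C, fun n => ?_⟩ n₀ fun n hn => ?_
    · simp only [← hxa]
      split_ifs
      · exact hC n
      · simpa using hC0
    · rw [← hxa, if_pos hn]
  rw [h3, h2]
  exact star_mul_self_nonneg _

theorem lim_mono (hω : IsFreeUltrafilter ω) (hU : IsTracialUltrapower ω M Mω τ limω) {x y : ℕ → Op H}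
    (hx : SeqIn (M : Set (Op H)) x) (hbx : Bdd x) (hy : SeqIn (M : Set (Op H)) y) (hby : Bdd y)
    (n₀ : ℕ) (h : ∀ n ≥ n₀, x n ≤ y n) : limω x ≤ limω y := by
  rw [← sub_nonneg, ← lim_sub hU hy hby hx hbx]
  exact lim_nonneg hω hU (fun n => sub_mem (hy n) (hx n)) (bdd_sub hby hbx) n₀ fun n hn => sub_nonneg.mpr (h n hn)

theorem lim_tr_le (hω : IsFreeUltrafilter ω) (hU : IsTracialUltrapower ω M Mω τ limω) {x : ℕ → Op H}
    (hx : SeqIn (M : Set (Op H)) x) (hbx : Bdd x) (n₀ : ℕ) (c : ℝ) (h : ∀ n ≥ n₀, (τ (x n)).re ≤ c) :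
    (τ (limω x)).re ≤ c := by
  have h1 := (Complex.continuous_re.tendsto _).comp (hU.tr x hx hbx)
  refine le_of_tendsto h1 ?_
  filter_upwards [ev_ω hω n₀] with n hn
  exact h n hn
end


section
variable {H : Type u} [NormedAddCommGroup H] [InnerProductSpace ℂ H] [CompleteSpace H]
variable {ω : Ultrafilter ℕ} {M Mω : VonNeumannAlgebra H} {τ : Op H →ₗ[ℂ] ℂ} {limω : (ℕ → Op H) → Op H}

theorem op_nonneg {T : Op H} : 0 ≤ T ↔ ∀ ξ, 0 ≤ inner ℂ (T ξ) ξ := by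
  rw [ContinuousLinearMap.nonneg_iff_isPositive, ContinuousLinearMap.isPositive_iff_complex]
  refine forall_congr' fun ξ => ?_
  rw [Complex.nonneg_iff]
  constructor
  · rintro ⟨h1, h2⟩
    refine ⟨h2, ?_⟩
    have := congrArg Complex.im h1
    simpa using this
  · rintro ⟨h1, h2⟩
    refine ⟨?_, h1⟩
    apply Complex.ext
    · simp
    · simpa using h2

theorem sq_inner (d : Op H) (ξ : H) : inner ℂ ((star d * d) ξ) ξ = inner ℂ (d ξ) (d ξ) := by
  rw [ContinuousLinearMap.mul_apply, ContinuousLinearMap.star_eq_adjoint, ContinuousLinearMap.adjoint_inner_left]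

theorem op_sq {T : Op H} (h0 : 0 ≤ T) (h1 : ‖T‖ ≤ 1) (ξ : H) : ‖T ξ‖ ^ 2 ≤ (inner ℂ (T ξ) ξ).re := by
  obtain ⟨a, ha⟩ := CStarAlgebra.nonneg_iff_eq_star_mul_self.mp h0
  have h2 : ‖star a‖ ^ 2 ≤ 1 := by
    rw [norm_star, sq, ← CStarRing.norm_star_mul_self, ← ha]; exact h1
  have h3 : (inner ℂ (T ξ) ξ).re = ‖a ξ‖ ^ 2 := by
    rw [ha, sq_inner, ← inner_self_eq_norm_sq (𝕜 := ℂ)]; rfl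
  rw [h3, ha, ContinuousLinearMap.mul_apply]
  calc _ ≤ (‖star a‖ * ‖a ξ‖) ^ 2 := by gcongr; exact ContinuousLinearMap.le_opNorm _ _
    _ = ‖star a‖ ^ 2 * ‖a ξ‖ ^ 2 := by ring
    _ ≤ 1 * ‖a ξ‖ ^ 2 := by gcongr
    _ = _ := one_mul _

theorem op_mono {S T : Op H} (h : S ≤ T) (ξ : H) : (inner ℂ (S ξ) ξ).re ≤ (inner ℂ (T ξ) ξ).re := by
  have := (Complex.nonneg_iff.mp (op_nonneg.mp (sub_nonneg.mpr h) ξ)).1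
  rw [ContinuousLinearMap.sub_apply, inner_sub_left, Complex.sub_re] at this
  linarith

theorem cauchy_sq {x : ℕ → H} {t : ℕ → ℝ} (ht : Antitone t) (h0 : Tendsto t atTop (nhds 0))
    (h : ∀ k m, k ≤ m → ‖x k - x m‖ ^ 2 ≤ t k) : CauchySeq x := by
  refine cauchySeq_of_le_tendsto_0 (fun n => Real.sqrt (t n)) (fun n m N hn hm => ?_) ?_
  · rw [dist_eq_norm]
    refine Real.le_sqrt_of_sq_le ?_
    rcases le_total n m with hh | hh
    · exact (h n m hh).trans (ht hn)
    · rw [norm_sub_rev]; exact (h m n hh).trans (ht hm)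
  · have := (Real.continuous_sqrt.tendsto 0).comp h0
    rwa [Real.sqrt_zero] at this

theorem geo_sum (k m : ℕ) (hkm : k ≤ m) : ∑ j ∈ Finset.Ico k m, (2 : ℝ) ^ (j + 1) * (1 / 4) ^ j ≤ 4 * (1 / 2) ^ k := by
  induction hkm using Nat.decreasingInduction with
  | self => simp
  | of_succ k hk ih =>
    rw [Finset.sum_eq_sum_Ico_succ_bot hk]
    have : (2 : ℝ) ^ (k + 1) * (1 / 4) ^ k = 2 * (1 / 2) ^ k := by
      rw [pow_succ, mul_right_comm, ← mul_pow]; norm_num; ring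
    rw [this]
    rw [pow_succ] at ih
    linarith

/-- antitone sequences of positive contractions with traces tending to zero -/
theorem antitone_lim (hT : IsTracialState (Mω : Set (Op H)) τ) (u : ℕ → Op H) (hu : ∀ k, u k ∈ Mω)
    (h0 : ∀ k, 0 ≤ u k) (h1 : ∀ k, u k ≤ 1) (ha : Antitone u)
    (ht : Tendsto (fun k => (τ (u k)).re) atTop (nhds 0)) (ξ : H) :
    Tendsto (fun k => (inner ℂ (u k ξ) ξ).re) atTop (nhds 0) := by
  have hC : ∀ ξ, CauchySeq (fun n => u n ξ) := by
    intro ξ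
    have hanti : Antitone (fun k => (inner ℂ (u k ξ) ξ).re) := fun k m hkm => op_mono (ha hkm) ξ
    have hbd : BddBelow (Set.range (fun k => (inner ℂ (u k ξ) ξ).re)) :=
      ⟨0, by rintro _ ⟨k, rfl⟩; exact (Complex.nonneg_iff.mp (op_nonneg.mp (h0 k) ξ)).1⟩
    have hl := tendsto_atTop_ciInf hanti hbd
    set l := ⨅ k, (inner ℂ (u k ξ) ξ).re
    refine cauchy_sq (t := fun k => (inner ℂ (u k ξ) ξ).re - l) (fun k m hkm => sub_le_sub_right (hanti hkm) l)
      (by simpa using hl.sub_const l) fun k m hkm => ?_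
    have e0 : 0 ≤ u k - u m := sub_nonneg.mpr (ha hkm)
    have e1 : ‖u k - u m‖ ≤ 1 := by
      rw [CStarAlgebra.norm_le_one_iff_of_nonneg _ e0]
      exact (sub_le_self _ (h0 m)).trans (h1 k)
    have := op_sq e0 e1 ξ
    rw [ContinuousLinearMap.sub_apply, inner_sub_left, Complex.sub_re] at this
    have h3 : l ≤ (inner ℂ (u m ξ) ξ).re := ciInf_le hbd m
    linarith
  obtain ⟨v, hv⟩ := sot_lim hC
  have hin : ∀ ξ, Tendsto (fun k => inner ℂ (u k ξ) ξ) atTop (nhds (inner ℂ (v ξ) ξ)) := fun ξ =>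
    (hv ξ).inner tendsto_const_nhds
  have hvM : v ∈ Mω := vn_sot Mω hu hv
  have hv0 : 0 ≤ v := op_nonneg.mpr fun ξ =>
    ge_of_tendsto (hin ξ) (Eventually.of_forall fun k => op_nonneg.mp (h0 k) ξ)
  have hvu : ∀ k, v ≤ u k := fun k => by
    rw [← sub_nonneg, op_nonneg]
    intro ξ
    rw [ContinuousLinearMap.sub_apply, inner_sub_left]
    refine ge_of_tendsto ((hin ξ).const_sub _) ?_
    filter_upwards [eventually_ge_atTop k] with m hm
    have := op_nonneg.mp (sub_nonneg.mpr (ha hm)) ξ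
    rwa [ContinuousLinearMap.sub_apply, inner_sub_left] at this
  have hvz : v = 0 := tr_zero hT hvM hv0
    (ge_of_tendsto ht (Eventually.of_forall fun k => tr_mono hT hvM (hu k) (hvu k)))
  have := (Complex.continuous_re.tendsto _).comp (hin ξ)
  simpa [hvz, Function.comp_def] using this

theorem complete_fast (hω : IsFreeUltrafilter ω) (hU : IsTracialUltrapower ω M Mω τ limω)
    (hTM : IsTracialState (M : Set (Op H)) τ) (y : ℕ → Op H) (hy : ∀ n, y n ∈ M) (C : ℝ) (hC : ∀ n, ‖y n‖ ≤ C)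
    (hf : ∀ j, (τ (star (y j - y (j + 1)) * (y j - y (j + 1)))).re ≤ (1 / 4) ^ j) :
    ∃ z ∈ M, Tendsto (fun n => (τ (star (y n - z) * (y n - z))).re) atTop (nhds 0) := by
  let D : ℕ → Op H := fun j => (2 : ℝ) ^ (j + 1) • (star (y j - y (j + 1)) * (y j - y (j + 1)))
  have hsqM : ∀ a ∈ M, star a * a ∈ M := fun a ha => mul_mem (star_mem ha) ha
  have hDM : ∀ j, D j ∈ M := fun j => vn_rsmul M _ (hsqM _ (sub_mem (hy _) (hy _)))
  have hD0 : ∀ j, 0 ≤ D j := fun j => smul_nonneg (by positivity) (star_mul_self_nonneg _)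
  let s : ℕ → ℕ → Op H := fun k m => ∑ j ∈ Finset.Ico k m, D j
  have hsM : ∀ k m, s k m ∈ M := fun k m => sum_mem fun j _ => hDM j
  have hs0 : ∀ k m, 0 ≤ s k m := fun k m => Finset.sum_nonneg fun j _ => hD0 j
  have hsle : ∀ k m k' m', k' ≤ k → m ≤ m' → s k m ≤ s k' m' := fun k m k' m' h1 h2 =>
    Finset.sum_le_sum_of_subset_of_nonneg (Finset.Ico_subset_Ico h1 h2) fun j _ _ => hD0 j
  have hst : ∀ k m, k ≤ m → (τ (s k m)).re ≤ 4 * (1 / 2) ^ k := fun k m hkm => by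
    refine le_trans ?_ (geo_sum k m hkm)
    rw [map_sum, Complex.re_sum]
    refine Finset.sum_le_sum fun j _ => ?_
    rw [tr_rsmul]
    gcongr
    exact hf j
  let w : ℕ → ℕ → Op H := fun k m => ff (s k m)
  have hwM : ∀ k, SeqIn (M : Set (Op H)) (w k) := fun k m => vn_cfc M _ (hsM k m)
  have hwb : ∀ k, Bdd (w k) := fun k => ⟨1, fun m => ff_norm (hs0 k m)⟩
  have hwle : ∀ k m k' m', k' ≤ k → m ≤ m' → w k m ≤ w k' m' := fun k m k' m' h1 h2 =>
    ff_mono (hs0 _ _) (hsle _ _ _ _ h1 h2)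
  set Q := 1 + (2 * C) ^ 2 with hQ
  have hQ0 : 0 ≤ Q := by positivity
  have hyw : ∀ k m, k ≤ m → star (y k - y m) * (y k - y m) ≤ Q • w k m := fun k m hkm => by
    have e0 : 0 ≤ star (y k - y m) * (y k - y m) := star_mul_self_nonneg _
    have e1 : ‖star (y k - y m) * (y k - y m)‖ ≤ (2 * C) ^ 2 := by
      rw [CStarRing.norm_star_mul_self, ← sq]
      gcongr
      exact (norm_sub_le _ _).trans (by linarith [hC k, hC m])
    refine (ff_ge e0 e1).trans ?_
    refine smul_le_smul_of_nonneg_left (ff_mono e0 ?_) hQ0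
    refine le_trans ?_ (tele y k m hkm)
    have h1 : (1 : ℝ) ≤ 2 ^ k := one_le_pow₀ (by norm_num)
    have := smul_le_smul_of_nonneg_right h1 e0
    rwa [one_smul] at this
  let u : ℕ → Op H := fun k => limω (w k)
  have huM : ∀ k, u k ∈ Mω := fun k => hU.mem _ (hwM k) (hwb k)
  have hu0 : ∀ k, 0 ≤ u k := fun k => lim_nonneg hω hU (hwM k) (hwb k) 0 fun n _ => ff_nonneg (hs0 k n)
  have hcb : ∀ a : Op H, Bdd (fun _ : ℕ => a) := fun a => ⟨‖a‖, fun _ => le_rfl⟩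
  have hu1 : ∀ k, u k ≤ 1 := fun k => by
    rw [← hU.diag 1 (one_mem _)]
    refine lim_mono hω hU (hwM k) (hwb k) (fun _ => one_mem _) (hcb 1) 0 fun n _ => ?_
    exact (CStarAlgebra.norm_le_one_iff_of_nonneg _ (ff_nonneg (hs0 k n))).mp (ff_norm (hs0 k n))
  have hua : Antitone u := fun k m hkm =>
    lim_mono hω hU (hwM m) (hwb m) (hwM k) (hwb k) 0 fun n _ => hwle _ _ _ _ hkm le_rfl
  have hut : ∀ k, (τ (u k)).re ≤ 4 * (1 / 2) ^ k := fun k =>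
    lim_tr_le hω hU (hwM k) (hwb k) k _ fun n hn =>
      (tr_mono hTM (hwM k n) (hsM k n) (ff_le (hs0 k n))).trans (hst k n hn)
  have hgeo : Tendsto (fun k : ℕ => (4 : ℝ) * (1 / 2) ^ k) atTop (nhds 0) := by
    have := (tendsto_pow_atTop_nhds_zero_of_lt_one (r := (1 / 2 : ℝ)) (by norm_num) (by norm_num)).const_mul 4
    simpa using this
  have hutend : Tendsto (fun k => (τ (u k)).re) atTop (nhds 0) :=
    squeeze_zero (fun k => (Complex.nonneg_iff.mp (tr_nonneg hU.traceState (huM k) (hu0 k))).1) hut hgeo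
  have hlim := antitone_lim hU.traceState u huM hu0 hu1 hua hutend
  have hyu : ∀ k m, k ≤ m → star (y k - y m) * (y k - y m) ≤ Q • u k := fun k m hkm => by
    have hM1 : star (y k - y m) * (y k - y m) ∈ M := hsqM _ (sub_mem (hy _) (hy _))
    have e : Q • u k = limω (fun n => (Q : ℂ) • w k n) := by
      rw [hU.map_smul _ _ (hwM k) (hwb k), Complex.coe_smul]
    rw [e, ← hU.diag _ hM1]
    refine lim_mono hω hU (fun _ => hM1) (hcb _) (fun n => vn_smul M _ (hwM k n)) ?_ m fun n hn => ?_
    · exact ⟨‖(Q : ℂ)‖ * 1, fun n => by rw [norm_smul]; gcongr; exact ff_norm (hs0 k n)⟩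
    · rw [Complex.coe_smul]
      exact (hyw k m hkm).trans (smul_le_smul_of_nonneg_left (hwle _ _ _ _ le_rfl hn) hQ0)
  have hQin : ∀ k ξ, inner ℂ ((Q • u k) ξ) ξ = (Q : ℂ) * inner ℂ (u k ξ) ξ := fun k ξ => by
    rw [← Complex.coe_smul, ContinuousLinearMap.smul_apply, inner_smul_left]; simp
  have hyC : ∀ ξ, CauchySeq (fun n => y n ξ) := fun ξ => by
    refine cauchy_sq (t := fun k => Q * (inner ℂ (u k ξ) ξ).re) (fun k m hkm => ?_) ?_ fun k m hkm => ?_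
    · exact mul_le_mul_of_nonneg_left (op_mono (hua hkm) ξ) hQ0
    · simpa using (hlim ξ).const_mul Q
    · have := op_mono (hyu k m hkm) ξ
      rw [hQin, Complex.re_ofReal_mul, sq_inner] at this
      refine le_trans (le_of_eq ?_) this
      rw [← ContinuousLinearMap.sub_apply, ← inner_self_eq_norm_sq (𝕜 := ℂ)]; rfl
  obtain ⟨z, hz⟩ := sot_lim hyC
  have hzM : z ∈ M := vn_sot M hy hz
  have hzu : ∀ k, star (y k - z) * (y k - z) ≤ Q • u k := fun k => by
    rw [← sub_nonneg, op_nonneg]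
    intro ξ
    rw [ContinuousLinearMap.sub_apply, inner_sub_left, sq_inner]
    have l1 : Tendsto (fun m => (y k - y m) ξ) atTop (nhds ((y k - z) ξ)) := by
      simp only [ContinuousLinearMap.sub_apply]; exact (hz ξ).const_sub _
    refine ge_of_tendsto ((l1.inner l1).const_sub _) ?_
    filter_upwards [eventually_ge_atTop k] with m hm
    have := op_nonneg.mp (sub_nonneg.mpr (hyu k m hm)) ξ
    rwa [ContinuousLinearMap.sub_apply, inner_sub_left, sq_inner] at this
  refine ⟨z, hzM, ?_⟩
  refine squeeze_zero (g := fun k => Q * (τ (u k)).re)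
    (fun k => (Complex.nonneg_iff.mp (hTM.pos _ (sub_mem (hy k) hzM))).1) (fun k => ?_) (by simpa using hutend.const_mul Q)
  rw [← tr_rsmul]
  exact tr_mono hU.traceState (hU.subset (hsqM _ (sub_mem (hy k) hzM))) (vn_rsmul Mω _ (huM k)) (hzu k)

theorem complete_M (hω : IsFreeUltrafilter ω) (hU : IsTracialUltrapower ω M Mω τ limω)
    (hTM : IsTracialState (M : Set (Op H)) τ) (y : ℕ → Op H) (hy : ∀ n, y n ∈ M) (C : ℝ) (hC : ∀ n, ‖y n‖ ≤ C)
    (hf : ∀ ε > 0, ∃ n₀, ∀ m ≥ n₀, ∀ n ≥ n₀, (τ (star (y m - y n) * (y m - y n))).re < ε) :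
    ∃ z ∈ M, Tendsto (fun n => (τ (star (y n - z) * (y n - z))).re) atTop (nhds 0) := by
  choose n₀ hn using fun j : ℕ => hf ((1 / 4) ^ j) (by positivity)
  obtain ⟨φ, hφ, hφn⟩ := Filter.extraction_forall_of_eventually (P := fun j n => n₀ j ≤ n)
    (fun j => eventually_ge_atTop (n₀ j))
  obtain ⟨z, hzM, hz⟩ := complete_fast hω hU hTM (fun j => y (φ j)) (fun j => hy _) C (fun j => hC _)
    (fun j => (hn j _ (hφn j) _ ((hφn j).trans (hφ (Nat.lt_succ_self j)).le)).le)
  refine ⟨z, hzM, ?_⟩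
  have h1 : Tendsto (fun n => (τ (star (y n - y (φ n)) * (y n - y (φ n)))).re) atTop (nhds 0) := by
    rw [Metric.tendsto_atTop]
    intro ε hε
    obtain ⟨n₁, hn₁⟩ := hf ε hε
    refine ⟨n₁, fun n hn => ?_⟩
    rw [Real.dist_eq, sub_zero, abs_of_nonneg (Complex.nonneg_iff.mp (hTM.pos _ (sub_mem (hy _) (hy _)))).1]
    exact hn₁ n hn _ (hn.le.trans (hφ.id_le n))
  have hsqM : ∀ a ∈ M, star a * a ∈ M := fun a ha => mul_mem (star_mem ha) ha
  refine squeeze_zero (g := fun n => 2 * (τ (star (y n - y (φ n)) * (y n - y (φ n)))).re +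
      2 * (τ (star (y (φ n) - z) * (y (φ n) - z))).re)
    (fun k => (Complex.nonneg_iff.mp (hTM.pos _ (sub_mem (hy k) hzM))).1) (fun n => ?_) (by simpa using (h1.const_mul 2).add (hz.const_mul 2))
  have := sq_add_le (y n - y (φ n)) (y (φ n) - z)
  rw [sub_add_sub_cancel] at this
  have h2 := tr_mono hTM (hsqM _ (sub_mem (hy n) hzM)) (add_mem (vn_rsmul M 2 (hsqM _ (sub_mem (hy _) (hy _))))
    (vn_rsmul M 2 (hsqM _ (sub_mem (hy _) hzM)))) this
  rwa [map_add, Complex.add_re, tr_rsmul, tr_rsmul] at h2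
end


section
variable {H : Type u} [NormedAddCommGroup H] [InnerProductSpace ℂ H] [CompleteSpace H]

theorem Setup.dist_le {A : Type u} [CStarAlgebra A] {τ : A →ₗ[ℂ] ℂ} {N : StarSubalgebra ℂ A} {E : A →ₗ[ℂ] A}
    (h : Setup τ N E) {u x : A} (hu : u ∈ unitary A) (hx : x ∈ N) :
    1 - (τ (star (E u) * E u)).re ≤ (τ (star (u - x) * (u - x))).re := by
  have h0 := (Complex.nonneg_iff.mp (h.pos (E u - x))).1
  have h1 : τ (star (E u) * x) = τ (star u * x) := by rw [← h.estar, h.tE' hx]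
  have h2 : τ (star x * E u) = τ (star x * u) := h.tE (star_mem hx) u
  have h3 : τ (star u * u) = 1 := by rw [(Unitary.mem_iff.mp hu).1, h.one]
  simp only [star_sub, sub_mul, mul_sub, map_sub, Complex.sub_re, h1, h2] at h0
  simp only [star_sub, sub_mul, mul_sub, map_sub, Complex.sub_re, h3, Complex.one_re]
  linarith

noncomputable instance vnCStar (M : VonNeumannAlgebra H) : CStarAlgebra M.toStarSubalgebra :=
  haveI : IsClosed (M.toStarSubalgebra : Set (Op H)) := vn_closed M
  StarSubalgebra.cstarAlgebra M.toStarSubalgebra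

/-- expectation as a linear map -/
def EL {τ : Op H →ₗ[ℂ] ℂ} {M N : VonNeumannAlgebra H} {EN : Op H → Op H}
    (hE : IsCondExp τ (M : Set (Op H)) (N : Set (Op H)) EN) (hNM : (N : Set (Op H)) ⊆ (M : Set (Op H))) :
    M.toStarSubalgebra →ₗ[ℂ] M.toStarSubalgebra where
  toFun x := ⟨EN x.1, hNM (hE.mem _ x.2)⟩
  map_add' x y := Subtype.ext (hE.map_add _ x.2 _ y.2)
  map_smul' c x := Subtype.ext (hE.map_smul c _ x.2)

theorem mkSetup (ω : Ultrafilter ℕ) (hω : IsFreeUltrafilter ω)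
    (M N Mω : VonNeumannAlgebra H) (τ : Op H →ₗ[ℂ] ℂ) (limω : (ℕ → Op H) → Op H)
    (EN : Op H → Op H)
    (hM : IsII1Factor M τ) 
    (hNM : (N : Set (Op H)) ⊆ (M : Set (Op H)))
    (hirr : relComm (N : Set (Op H)) (M : Set (Op H)) = scalars H)
    (hE : IsCondExp τ (M : Set (Op H)) (N : Set (Op H)) EN)
    (hU : IsTracialUltrapower ω M Mω τ limω) :
    Setup (A := M.toStarSubalgebra) (τ.comp M.toStarSubalgebra.subtype.toAlgHom.toLinearMap)
      (N.toStarSubalgebra.comap M.toStarSubalgebra.subtype) (EL hE hNM) where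
  one := hM.trace.map_one
  tr x y := hM.trace.tracial _ x.2 _ y.2
  pos x := hM.trace.pos _ x.2
  faith x hx := Subtype.ext (hM.trace.faithful _ x.2 hx)
  mem x := hE.mem _ x.2
  fix x hx := Subtype.ext (hE.fix _ hx)
  bim a ha x b hb := Subtype.ext (hE.bimod _ ha _ x.2 _ hb)
  etr x := hE.tr _ x.2
  closed := (vn_closed N).preimage continuous_subtype_val
  complete y C hC hf := by
    obtain ⟨z, hz, hl⟩ := complete_M hω hU hM.trace (fun n => (y n).1) (fun n => (y n).2) C hC hf
    exact ⟨⟨z, hz⟩, hl⟩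
  irr x hx := by
    have : x.1 ∈ relComm (N : Set (Op H)) (M : Set (Op H)) :=
      ⟨x.2, fun y hy => congrArg Subtype.val (hx ⟨y, hNM hy⟩ hy)⟩
    rw [hirr] at this
    obtain ⟨c, hc⟩ := this
    exact ⟨c, Subtype.ext hc⟩

theorem final
    (ω : Ultrafilter ℕ) (hω : IsFreeUltrafilter ω)
    (M N Mω : VonNeumannAlgebra H) (τ : Op H →ₗ[ℂ] ℂ) (limω : (ℕ → Op H) → Op H)
    (EN : Op H → Op H)
    (hM : IsII1Factor M τ)
    (hMhf : IsHyperfinite M)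
    (hNM : (N : Set (Op H)) ⊆ (M : Set (Op H)))
    (hirr : relComm (N : Set (Op H)) (M : Set (Op H)) = scalars H)
    (hE : IsCondExp τ (M : Set (Op H)) (N : Set (Op H)) EN)
    (hU : IsTracialUltrapower ω M Mω τ limω)
    (hcs : relComm (M : Set (Op H)) (Mω : Set (Op H)) ⊆
      ultrapowerSet limω (N : Set (Op H))) :
    HasFiniteIndex (M : Set (Op H)) EN := by
  have h := mkSetup ω hω M N Mω τ limω EN hM hNM hirr hE hU
  obtain ⟨A, hmono, hAM, hfd, hcc⟩ := hMhf
  have key : ∃ n, ∀ u ∈ unitary M.toStarSubalgebra,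
      (∀ x ∈ (A n).comap M.toStarSubalgebra.subtype, x * u = u * x) →
      1 / 2 ≤ ((τ.comp M.toStarSubalgebra.subtype.toAlgHom.toLinearMap)
        (star (EL hE hNM u) * EL hE hNM u)).re := by
    by_contra! hcon
    choose u hu hcomm hlt using hcon
    have hus : SeqIn (M : Set (Op H)) (fun n => (u n).1) := fun n => (u n).2
    have hub : Bdd (fun n => (u n).1) := ⟨1, fun n => by
      have h1 : star (u n).1 * (u n).1 = 1 := congrArg Subtype.val (Unitary.mem_iff.mp (hu n)).1
      have h2 := CStarRing.norm_star_mul_self (x := (u n).1)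
      have h3 : ‖(1 : Op H)‖ ≤ 1 := ContinuousLinearMap.norm_id_le
      rw [h1] at h2
      nlinarith [norm_nonneg (u n).1]⟩
    have hz : limω (fun n => (u n).1) ∈ Set.centralizer (⋃ n, (A n : Set (Op H))) := by
      intro a ha
      obtain ⟨k, hk⟩ := Set.mem_iUnion.mp ha
      have haM := hAM k hk
      have hac : SeqIn (M : Set (Op H)) (fun _ => a) := fun _ => haM
      have hab : Bdd (fun _ : ℕ => a) := ⟨‖a‖, fun _ => le_rfl⟩
      have hmb1 : Bdd (fun n => a * (u n).1) := by
        obtain ⟨C, hC⟩ := hub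
        exact ⟨‖a‖ * C, fun n => (norm_mul_le _ _).trans (mul_le_mul_of_nonneg_left (hC n) (norm_nonneg _))⟩
      have hmb2 : Bdd (fun n => (u n).1 * a) := by
        obtain ⟨C, hC⟩ := hub
        exact ⟨C * ‖a‖, fun n => (norm_mul_le _ _).trans (mul_le_mul_of_nonneg_right (hC n) (norm_nonneg _))⟩
      have h1 := hU.map_mul _ _ hac hab hus hub
      have h2 := hU.map_mul _ _ hus hub hac hab
      rw [hU.diag a haM] at h1 h2
      rw [← h1, ← h2]
      refine lim_congr hω hU (fun n => mul_mem (hac n) (hus n)) hmb1 (fun n => mul_mem (hus n) (hac n)) hmb2 k fun n hn => ?_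
      exact congrArg Subtype.val (hcomm n ⟨a, haM⟩ (hmono hn hk))
    have hzr : limω (fun n => (u n).1) ∈ relComm (M : Set (Op H)) (Mω : Set (Op H)) := by
      refine ⟨hU.mem _ hus hub, fun y hy => ?_⟩
      rw [← hcc] at hy
      exact (hy _ hz).symm
    obtain ⟨x, hxN, hxb, hx⟩ := hcs hzr
    have hxM : SeqIn (M : Set (Op H)) x := fun n => hNM (hxN n)
    have h0 := (hU.eq_zero _ (fun n => sub_mem (hus n) (hxM n)) (bdd_sub hub hxb)).mp
      (by rw [lim_sub hU hus hub hxM hxb, hx, sub_self])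
    obtain ⟨n, hn⟩ := (h0.eventually (gt_mem_nhds (show (0:ℝ) < 1 / 2 by norm_num))).exists
    have h3 := h.dist_le (hu n) (x := ⟨x n, hxM n⟩) (hxN n)
    have h4 := hlt n
    have h5 : ((τ.comp M.toStarSubalgebra.subtype.toAlgHom.toLinearMap)
        (star (u n - ⟨x n, hxM n⟩) * (u n - ⟨x n, hxM n⟩))).re ≤ ‖τ (star ((u n).1 - x n) * ((u n).1 - x n))‖ :=
      Complex.re_le_norm _
    linarith
  obtain ⟨n, hn⟩ := key
  have hfin : FiniteDimensional ℂ ((A n).comap M.toStarSubalgebra.subtype) := by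
    obtain ⟨s, hs⟩ := hfd n
    have : FiniteDimensional ℂ (Submodule.span ℂ (s : Set (Op H))) := FiniteDimensional.span_finset ℂ s
    let f : ((A n).comap M.toStarSubalgebra.subtype) →ₗ[ℂ] (Submodule.span ℂ (s : Set (Op H))) :=
      { toFun := fun x => ⟨x.1.1, hs x.2⟩
        map_add' := fun _ _ => rfl
        map_smul' := fun _ _ => rfl }
    exact FiniteDimensional.of_injective f fun x y hxy => Subtype.ext (Subtype.ext (congrArg (fun t => t.1) hxy : x.1.1 = y.1.1))
  obtain ⟨C, hC, hS⟩ := h.main _ hfin hn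
  refine ⟨C, hC, fun x hx hpos => ?_⟩
  obtain ⟨a, ha, rfl⟩ := vn_sqrt M hx ((ContinuousLinearMap.nonneg_iff_isPositive _).mpr hpos)
  obtain ⟨S, hS⟩ := hS ⟨a, ha⟩
  have h6 : (C : ℂ) • EN (star a * a) - star a * a = star S.1 * S.1 := congrArg Subtype.val hS
  rw [Complex.coe_smul] at h6
  rw [h6]
  exact (ContinuousLinearMap.nonneg_iff_isPositive _).mp (star_mul_self_nonneg S.1)
end

/-- Let `N ⊆ M` be hyperfinite II₁ factors with `N' ∩ M = ℂ1` and let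
`ω` be a free ultrafilter on ℕ. If `M' ∩ M^ω ⊆ N^ω` then the Jones index `[M : N]`
is finite. -/
theorem finiteIndex_of_central_sequence_inclusion
    {H : Type u} [NormedAddCommGroup H] [InnerProductSpace ℂ H] [CompleteSpace H]
    (ω : Ultrafilter ℕ) (hω : IsFreeUltrafilter ω)
    (M N Mω : VonNeumannAlgebra H) (τ : Op H →ₗ[ℂ] ℂ) (limω : (ℕ → Op H) → Op H)
    (EN : Op H → Op H)
    (hM : IsII1Factor M τ) (hN : IsII1Factor N τ)
    (hMhf : IsHyperfinite M) (hNhf : IsHyperfinite N)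
    (hNM : (N : Set (Op H)) ⊆ (M : Set (Op H)))
    (hirr : relComm (N : Set (Op H)) (M : Set (Op H)) = scalars H)
    (hE : IsCondExp τ (M : Set (Op H)) (N : Set (Op H)) EN)
    (hU : IsTracialUltrapower ω M Mω τ limω)
    (hcs : relComm (M : Set (Op H)) (Mω : Set (Op H)) ⊆
      ultrapowerSet limω (N : Set (Op H))) :
    HasFiniteIndex (M : Set (Op H)) EN := by
  exact final ω hω M N Mω τ limω EN hM hMhf hNM hirr hE hU hcs

end PopaQ
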